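/- arXiv:1705.08553 — 3 statements merged into one kernel-verified Lean document; each statement's English description precedes it below -/
import Mathlib

section
/- Lieb-Robinson bound for lattice fermions, commutator version: Let Φ ∈ B_G⁺(I) be an even time-dependent interaction, Λ ⊆ Γ finite, and let τ_{t,s}^Λ be the finite-volume Heisenberg dynamics generated by H_Λ(t). Let X, Y ⊆ Λ with X ∩ Y = ∅. If A ∈ 𝔄_X, B ∈ 𝔄_Y and [A,B] = 0, then for all s, t ∈ I with s ≤ t one has ‖[τ_{t,s}^Λ(A), B]‖ ≤ 2‖A‖‖B‖ (exp(2∫_s^t ‖Φ‖_G(r) dr) − 1) ∑_{x ∈ ∂_Φ X} ∑_{y ∈ Y} G(x,y). -/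
open scoped Classical

/-- The canonical anticommutation relations for a family `a x` of annihilation
operators in a C*-algebra. -/
def IsCAR {Γ A : Type*} [Ring A] [StarRing A] (a : Γ → A) : Prop :=
  (∀ x y, a x * a y + a y * a x = 0) ∧
  (∀ x y, star (a x) * star (a y) + star (a y) * star (a x) = 0) ∧
  (∀ x y, a x * star (a y) + star (a y) * a x = if x = y then (1 : A) else 0)

/-- The four possible factors of a monomial at a site `x`:
`1`, `a x`, `a x *`, and `a x * a x`. -/
def carFactor {Γ A : Type*} [Ring A] [StarRing A] (a : Γ → A) (k : Fin 4) (x : Γ) : A :=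
  match k with
  | 0 => 1
  | 1 => a x
  | 2 => star (a x)
  | 3 => star (a x) * a x

/-- The monomial with factor pattern `k` along the enumeration `l` of a finite set of sites. -/
def carMonomial {Γ A : Type*} [Ring A] [StarRing A] (a : Γ → A) (l : List Γ)
    (k : Γ → Fin 4) : A :=
  (l.map fun x => carFactor a (k x) x).prod

/-- The number of odd factors (`a x` or `a x *`) of the monomial with pattern `k` along `l`. -/
def carOddCount {Γ : Type*} (l : List Γ) (k : Γ → Fin 4) : ℕ :=
  l.countP fun x => decide (k x = 1 ∨ k x = 2)

/-- `𝔄_X`: the linear span of the monomials supported in the finite set `X`. -/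
def carSpan {Γ A : Type*} [Ring A] [StarRing A] [Algebra ℂ A] (a : Γ → A) (X : Finset Γ) :
    Submodule ℂ A :=
  Submodule.span ℂ {m | ∃ (l : List Γ) (k : Γ → Fin 4),
    l.Nodup ∧ l.toFinset = X ∧ m = carMonomial a l k}

/-- `𝔄_X⁺`: the linear span of the even monomials supported in the finite set `X`. -/
def carSpanEven {Γ A : Type*} [Ring A] [StarRing A] [Algebra ℂ A] (a : Γ → A) (X : Finset Γ) :
    Submodule ℂ A :=
  Submodule.span ℂ {m | ∃ (l : List Γ) (k : Γ → Fin 4),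
    l.Nodup ∧ l.toFinset = X ∧ Even (carOddCount l k) ∧ m = carMonomial a l k}

set_option linter.unusedSectionVars false

section helper_car
variable {Γ A : Type*} [NormedRing A] [StarRing A] [CStarRing A] [NormedAlgebra ℂ A]

theorem lr_factor_comm {a : Γ → A} (hCAR : IsCAR a) {x y : Γ} (hxy : x ≠ y) (k : Fin 4)
    (c : A) (hc : c = a x ∨ c = star (a x)) :
    c * carFactor a k y = (if k = 1 ∨ k = 2 then (-1 : A) else 1) * (carFactor a k y * c) := by
  obtain ⟨h1, h2, h3⟩ := hCAR
  have e1 : c * a y = - (a y * c) := by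
    rcases hc with rfl | rfl
    · exact eq_neg_of_add_eq_zero_left (h1 x y)
    · have := h3 y x
      rw [if_neg hxy.symm, add_comm] at this
      exact eq_neg_of_add_eq_zero_left this
  have e2 : c * star (a y) = - (star (a y) * c) := by
    rcases hc with rfl | rfl
    · have := h3 x y
      rw [if_neg hxy] at this
      exact eq_neg_of_add_eq_zero_left this
    · exact eq_neg_of_add_eq_zero_left (h2 x y)
  fin_cases k
  · simp [carFactor]
  · simp [carFactor, e1]
  · simp [carFactor, e2]
  · simp only [carFactor]
    rw [← mul_assoc, e2, neg_mul, mul_assoc, e1]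
    simp [mul_assoc]

theorem lr_monomial_comm {a : Γ → A} (hCAR : IsCAR a) {x : Γ} (k : Γ → Fin 4)
    (c : A) (hc : c = a x ∨ c = star (a x)) (l : List Γ) (hl : x ∉ l) :
    c * carMonomial a l k = (-1 : A) ^ (carOddCount l k) * (carMonomial a l k * c) := by
  induction l with
  | nil => simp [carMonomial, carOddCount]
  | cons y l ih =>
    simp only [List.mem_cons, not_or] at hl
    have ih := ih hl.2
    have e : carMonomial a (y :: l) k = carFactor a (k y) y * carMonomial a l k := by
      simp [carMonomial]
    have e' : (-1 : A) ^ (carOddCount (y :: l) k) =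
        (if k y = 1 ∨ k y = 2 then (-1 : A) else 1) * (-1 : A) ^ (carOddCount l k) := by
      simp only [carOddCount, List.countP_cons]
      split_ifs with h1 h2 h2 <;> simp_all [pow_succ]
    have hcm : ∀ z : A, (-1 : A) ^ (carOddCount l k) * z = z * (-1 : A) ^ (carOddCount l k) := by
      intro z
      exact ((Commute.neg_one_left z).pow_left _).eq
    rw [e, e', ← mul_assoc, lr_factor_comm hCAR hl.1 (k y) c hc]
    rw [mul_assoc, mul_assoc, ih, mul_assoc, mul_assoc]
    congr 1
    rw [← mul_assoc, ← hcm, mul_assoc]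

theorem lr_even_comm_gen {a : Γ → A} (hCAR : IsCAR a) {Z : Finset Γ} {P : A}
    (hP : P ∈ carSpanEven a Z) {x : Γ} (hx : x ∉ Z)
    (c : A) (hc : c = a x ∨ c = star (a x)) : P * c = c * P := by
  unfold carSpanEven at hP
  induction hP using Submodule.span_induction with
  | mem m hm =>
    obtain ⟨l, k, _, hl, he, rfl⟩ := hm
    have hx' : x ∉ l := by
      rw [← List.mem_toFinset, hl]; exact hx
    rw [lr_monomial_comm hCAR k c hc l hx', he.neg_one_pow, one_mul]
  | zero => simp
  | add u v _ _ hu hv => rw [add_mul, mul_add, hu, hv]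
  | smul r u _ hu => rw [smul_mul_assoc, mul_smul_comm, hu]

theorem lr_even_comm {a : Γ → A} (hCAR : IsCAR a) {Z X : Finset Γ} (hd : Disjoint Z X) {P Q : A}
    (hP : P ∈ carSpanEven a Z) (hQ : Q ∈ carSpan a X) : P * Q = Q * P := by
  unfold carSpan at hQ
  induction hQ using Submodule.span_induction with
  | mem m hm =>
    obtain ⟨l, k, hnd, hl, rfl⟩ := hm
    clear hnd
    have hl' : ∀ x ∈ l, x ∉ Z := by
      intro x hx
      rw [← List.mem_toFinset, hl] at hx
      exact fun hz => (Finset.disjoint_left.1 hd hz) hx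
    clear hl
    induction l with
    | nil => simp [carMonomial]
    | cons y l ih =>
      have e : carMonomial a (y :: l) k = carFactor a (k y) y * carMonomial a l k := by
        simp [carMonomial]
      have h1 : Commute P (carMonomial a l k) := ih (fun x hx => hl' x (by simp [hx]))
      have hy := hl' y (by simp)
      have c1 : Commute P (a y) := lr_even_comm_gen hCAR hP hy _ (Or.inl rfl)
      have c2 : Commute P (star (a y)) := lr_even_comm_gen hCAR hP hy _ (Or.inr rfl)
      have h2 : Commute P (carFactor a (k y) y) := by
        generalize k y = j
        fin_cases j
        · exact Commute.one_right _
        · exact c1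
        · exact c2
        · exact c2.mul_right c1
      rw [e]
      exact h2.mul_right h1
  | zero => simp
  | add u v _ _ hu hv => rw [add_mul, mul_add, hu, hv]
  | smul r u _ hu => rw [smul_mul_assoc, mul_smul_comm, hu]

theorem lr_even_le (a : Γ → A) (X : Finset Γ) : carSpanEven a X ≤ carSpan a X := by
  apply Submodule.span_mono
  rintro m ⟨l, k, h1, h2, _, h3⟩
  exact ⟨l, k, h1, h2, h3⟩

theorem lr_empty {a : Γ → A} {Q : A} (hQ : Q ∈ carSpan a ∅) (P : A) : P * Q = Q * P := by
  unfold carSpan at hQ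
  induction hQ using Submodule.span_induction with
  | mem m hm =>
    obtain ⟨l, k, _, hl, rfl⟩ := hm
    rw [List.toFinset_eq_empty_iff] at hl
    subst hl
    simp [carMonomial]
  | zero => simp
  | add u v _ _ hu hv => rw [add_mul, mul_add, hu, hv]
  | smul r u _ hu => rw [smul_mul_assoc, mul_smul_comm, hu]

theorem lr_star_I {a : Γ → A} (hCAR : IsCAR a) (x : Γ) :
    star (Complex.I • (1 : A)) = -(Complex.I • (1 : A)) := by
  obtain ⟨h1, h2, h3⟩ := hCAR
  have haa : a x * a x = 0 := by
    have := h1 x x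
    rw [← two_smul ℂ] at this
    simpa using this
  have hss : star (a x) * star (a x) = 0 := by rw [← star_mul, haa, star_zero]
  have has : a x * star (a x) + star (a x) * a x = 1 := by simpa using h3 x x
  set b := a x with hb
  set i1 : A := Complex.I • (1 : A) with hi1
  have hi1c : ∀ z, i1 * z = z * i1 := by intro z; simp [hi1]
  set j : A := star i1 with hj
  have hjc : ∀ z, j * z = z * j := by
    intro z
    have := congrArg star (hi1c (star z))
    simpa [← hj] using this.symm
  have hii : i1 * i1 = -1 := by simp [hi1, smul_smul]
  have hjj : j * j = -1 := by rw [hj, ← star_mul, hii]; simp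
  set q : A := i1 + j with hq
  have hqs : star q = q := by simp [hq, hj, add_comm]
  have hqc : ∀ z, q * z = z * q := by intro z; rw [hq, add_mul, mul_add, hi1c, hjc]
  have hqj : j * q = i1 * q := by
    rw [hq, mul_add, mul_add, hii, hjj, hjc i1, add_comm]
  set σ : A := star b * b - b * star b with hσ
  set ρ : A := b + star b with hρ
  have hσs : star σ = σ := by simp [hσ]
  have hρs : star ρ = ρ := by simp [hρ, add_comm]
  have hbsb : b * star b * b = b := by
    have : b * star b = 1 - star b * b := eq_sub_of_add_eq has
    rw [this, sub_mul, mul_assoc, haa]; simp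
  have hsbs : star b * b * star b = star b := by
    have := congrArg star hbsb
    simpa [mul_assoc] using this
  have hσσ : σ * σ = 1 := by
    have e1 : star b * b * (star b * b) = star b * b := by
      rw [← mul_assoc, hsbs]
    have e2 : b * star b * (b * star b) = b * star b := by
      rw [← mul_assoc, hbsb]
    have e3 : star b * b * (b * star b) = 0 := by
      rw [mul_assoc, ← mul_assoc b b, haa]; simp
    have e4 : b * star b * (star b * b) = 0 := by
      rw [mul_assoc, ← mul_assoc (star b) (star b), hss]; simp
    rw [hσ, mul_sub, sub_mul, sub_mul, e1, e2, e3, e4, ← has]; abel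
  have hρρ : ρ * ρ = 1 := by
    rw [hρ, mul_add, add_mul, add_mul, haa, hss, ← has]; abel
  have hac : σ * ρ + ρ * σ = 0 := by
    have e1 : star b * b * b = 0 := by rw [mul_assoc, haa, mul_zero]
    have e2 : b * star b * star b = 0 := by rw [mul_assoc, hss, mul_zero]
    have e3 : b * (star b * b) = b := by rw [← mul_assoc, hbsb]
    have e4 : star b * (b * star b) = star b := by rw [← mul_assoc, hsbs]
    have e5 : b * (b * star b) = 0 := by rw [← mul_assoc, haa, zero_mul]
    have e6 : star b * (star b * b) = 0 := by rw [← mul_assoc, hss, zero_mul]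
    rw [hσ, hρ]
    simp only [mul_add, add_mul, mul_sub, sub_mul, e1, e2, e3, e4, e5, e6, hbsb, hsbs]
    abel
  set c : A := q * (σ + i1 * ρ) with hcdef
  have hcs : star c = c := by
    rw [hcdef, star_mul, star_add, star_mul, hσs, hρs, hqs, ← hj, ← hqc, mul_add, mul_add,
      ← hjc ρ, ← mul_assoc, ← mul_assoc, hqc j, hqj, hqc i1]
  have hsq : (σ + i1 * ρ) * (σ + i1 * ρ) = 0 := by
    have : (σ + i1 * ρ) * (σ + i1 * ρ) =
        σ * σ + (i1 * i1) * (ρ * ρ) + i1 * (σ * ρ + ρ * σ) := by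
      simp only [mul_add, add_mul]
      rw [← mul_assoc σ i1 ρ, ← hi1c σ, mul_assoc i1 ρ (i1 * ρ), ← mul_assoc ρ i1 ρ, ← hi1c ρ]
      simp only [mul_assoc]
      abel
    rw [this, hσσ, hρρ, hii, hac]; simp
  have hcc : c * c = 0 := by
    calc c * c = q * (σ + i1 * ρ) * (q * (σ + i1 * ρ)) := rfl
      _ = q * ((σ + i1 * ρ) * q) * (σ + i1 * ρ) := by simp only [mul_assoc]
      _ = q * (q * (σ + i1 * ρ)) * (σ + i1 * ρ) := by rw [← hqc (σ + i1 * ρ)]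
      _ = q * q * ((σ + i1 * ρ) * (σ + i1 * ρ)) := by simp only [mul_assoc]
      _ = 0 := by rw [hsq, mul_zero]
  have hc0 : c = 0 := by
    have h := CStarRing.norm_star_mul_self (x := c)
    rw [hcs, hcc, norm_zero] at h
    have : ‖c‖ = 0 := by nlinarith [norm_nonneg c]
    exact norm_eq_zero.1 this
  have hA1 : q * (1 + i1 * (σ * ρ)) = 0 := by
    have : q * (1 + i1 * (σ * ρ)) = σ * c := by
      symm
      calc σ * c = σ * q * (σ + i1 * ρ) := by rw [hcdef, mul_assoc]
        _ = q * (σ * σ + (σ * i1) * ρ) := by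
          rw [← hqc σ, mul_assoc, mul_add]; simp only [mul_assoc]
        _ = _ := by rw [hσσ, ← hi1c σ]; simp only [mul_assoc]
    rw [this, hc0, mul_zero]
  have hA2 : q * (1 + i1 * (ρ * σ)) = 0 := by
    have : q * (1 + i1 * (ρ * σ)) = c * σ := by
      rw [hcdef, mul_assoc q, add_mul σ, hσσ, mul_assoc i1]
    rw [this, hc0, zero_mul]
  have hq0 : q = 0 := by
    have : q * (1 + i1 * (σ * ρ)) + q * (1 + i1 * (ρ * σ)) = (2 : ℂ) • q := by
      have : q * (1 + i1 * (σ * ρ)) + q * (1 + i1 * (ρ * σ)) =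
        q + q + q * (i1 * (σ * ρ + ρ * σ)) := by
        simp only [mul_add, mul_one]; abel
      rw [this, hac, two_smul]; simp
    rw [hA1, hA2, add_zero] at this
    simpa using this.symm
  rw [hq] at hq0
  exact eq_neg_of_add_eq_zero_right hq0

theorem lr_starModule {a : Γ → A} (hCAR : IsCAR a) (x : Γ) : StarModule ℂ A := by
  constructor
  intro c z
  have hr : ∀ (r : ℝ) (z : A), star (r • z) = r • star z := by
    intro r z
    exact map_real_smul (starAddEquiv : A ≃+ A) (by exact continuous_star) r z
  have hi : ∀ z : A, star (Complex.I • z) = -(Complex.I • star z) := by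
    intro z
    have : Complex.I • z = (Complex.I • (1 : A)) * z := by simp
    rw [this, star_mul, lr_star_I hCAR x]
    simp
  have e : ∀ (c : ℂ) (z : A), c • z = c.re • z + c.im • (Complex.I • z) := by
    intro c z
    conv_lhs => rw [← Complex.re_add_im c]
    rw [add_smul, mul_smul]
    simp only [Complex.coe_smul]
  rw [e c z, star_add, hr, hr, hi, e (star c) (star z)]
  simp
end helper_car

section helper_ode
variable {A : Type*} [NormedRing A] [StarRing A] [CStarRing A] [NormedAlgebra ℂ A]
  [CompleteSpace A] [StarModule ℂ A]

theorem lr_ici {E : Type*} [NormedAddCommGroup E] [NormedSpace ℝ E] {f : ℝ → E} {f' : E}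
    {s t r : ℝ} (h : HasDerivWithinAt f f' (Set.Icc s t) r) (hr : r ∈ Set.Ico s t) :
    HasDerivWithinAt f f' (Set.Ici r) r :=
  h.mono_of_mem_nhdsWithin
    (Filter.mem_of_superset (Icc_mem_nhdsGE hr.2) (Set.Icc_subset_Icc_left hr.1))

theorem lr_zero {E : Type*} [NormedAddCommGroup E] [NormedSpace ℝ E] {f f' : ℝ → E}
    {s t K : ℝ} (h : ∀ r ∈ Set.Icc s t, HasDerivWithinAt f (f' r) (Set.Icc s t) r)
    (h0 : f s = 0) (hb : ∀ r ∈ Set.Icc s t, ‖f' r‖ ≤ K * ‖f r‖) :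
    ∀ r ∈ Set.Icc s t, f r = 0 :=
  eq_zero_of_abs_deriv_le_mul_abs_self_of_eq_zero_right
    (fun r hr => (h r hr).continuousWithinAt)
    (fun r hr => lr_ici (h r (Set.Ico_subset_Icc_self hr)) hr) h0
    (fun r hr => hb r (Set.Ico_subset_Icc_self hr))

theorem lr_radial {E : Type*} [NormedAddCommGroup E] [NormedSpace ℝ E] (x y : E) :
    ‖(max 1 ‖x‖)⁻¹ • x - (max 1 ‖y‖)⁻¹ • y‖ ≤ 2 * ‖x - y‖ := by
  set p := max 1 ‖x‖ with hp
  set q := max 1 ‖y‖ with hq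
  have hp1 : 1 ≤ p := le_max_left _ _
  have hq1 : 1 ≤ q := le_max_left _ _
  have hyq : ‖y‖ ≤ q := le_max_right _ _
  have hpq : |q - p| ≤ ‖x - y‖ := by
    calc |q - p| ≤ |‖y‖ - ‖x‖| := by
          rw [hp, hq, max_comm 1 ‖y‖, max_comm 1 ‖x‖]
          exact abs_max_sub_max_le_abs _ _ _
      _ ≤ ‖y - x‖ := abs_norm_sub_norm_le _ _
      _ = ‖x - y‖ := norm_sub_rev _ _
  have e : p⁻¹ • x - q⁻¹ • y = p⁻¹ • (x - y) + (p⁻¹ * (q - p)) • (q⁻¹ • y) := by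
    rw [smul_sub, smul_smul, sub_add_eq_add_sub, sub_eq_sub_iff_add_eq_add]
    rw [add_assoc, add_right_inj]
    rw [← add_smul]
    congr 1
    field_simp
    ring
  have hpi : p⁻¹ ≤ 1 := inv_le_one_of_one_le₀ hp1
  have hpi0 : 0 ≤ p⁻¹ := by positivity
  have hqy : ‖q⁻¹ • y‖ ≤ 1 := by
    rw [norm_smul, Real.norm_of_nonneg (by positivity), inv_mul_le_iff₀ (by positivity)]
    simpa using hyq
  rw [e]
  calc _ ≤ ‖p⁻¹ • (x - y)‖ + ‖(p⁻¹ * (q - p)) • (q⁻¹ • y)‖ := norm_add_le _ _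
    _ ≤ ‖x - y‖ + ‖x - y‖ := by
      gcongr
      · rw [norm_smul, Real.norm_of_nonneg hpi0]
        exact mul_le_of_le_one_left (norm_nonneg _) hpi
      · rw [norm_smul, norm_mul, Real.norm_of_nonneg hpi0]
        have : p⁻¹ * ‖q - p‖ ≤ ‖x - y‖ :=
          (mul_le_of_le_one_left (norm_nonneg _) hpi).trans hpq
        calc _ ≤ ‖x - y‖ * 1 := by gcongr
          _ = _ := mul_one _
    _ = _ := by ring

theorem lr_starI (x : A) : star ((-Complex.I) • x) = Complex.I • star x := by
  rw [star_smul]; simp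

theorem lr_norm_le_one {v : A} (h : star v * v = 1) : ‖v‖ ≤ 1 := by
  have h1 : ‖(1 : A)‖ ≤ 1 := by
    rcases subsingleton_or_nontrivial A with hs | hn
    · rw [Subsingleton.elim (1 : A) 0]; simp
    · exact CStarRing.norm_one.le
  have h2 := CStarRing.norm_star_mul_self (x := v)
  rw [h] at h2
  nlinarith [norm_nonneg v]

theorem lr_exists_unitary {s t : ℝ} (hst : s ≤ t) (K : ℝ → A)
    (hK : ContinuousOn K (Set.Icc s t)) (hKs : ∀ r ∈ Set.Icc s t, star (K r) = K r) :
    ∃ V : ℝ → A, V s = 1 ∧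
      (∀ r ∈ Set.Icc s t, HasDerivWithinAt V ((-Complex.I) • (K r * V r)) (Set.Icc s t) r) ∧
      (∀ r ∈ Set.Icc s t, star (V r) * V r = 1) ∧
      (∀ r ∈ Set.Icc s t, V r * star (V r) = 1) ∧
      (∀ C : A, (∀ r ∈ Set.Icc s t, K r * C = C * K r) →
        ∀ r ∈ Set.Icc s t, V r * C = C * V r) := by
  obtain ⟨M, hM⟩ := isCompact_Icc.exists_bound_of_continuousOn hK
  have hM0 : 0 ≤ M := (norm_nonneg _).trans (hM s ⟨le_rfl, hst⟩)
  let P : A → A := fun x => (max 1 ‖x‖)⁻¹ • x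
  have hP1 : ∀ x, ‖P x‖ ≤ 1 := by
    intro x
    have : 0 < max 1 ‖x‖ := by positivity
    simp only [P]
    rw [norm_smul, Real.norm_of_nonneg (by positivity), inv_mul_le_iff₀ this]
    simp
  let F : ℝ → A → A := fun r x => (-Complex.I) • (K r * P x)
  have hPL : IsPicardLindelof F (⟨s, le_rfl, hst⟩ : Set.Icc s t) 1
      (M.toNNReal * (t - s).toNNReal) 0 M.toNNReal (M.toNNReal * 2) := by
    constructor
    · intro r hr
      apply LipschitzOnWith.of_dist_le_mul
      intro x _ y _
      rw [dist_eq_norm, dist_eq_norm]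
      simp only [F]
      rw [← smul_sub, ← mul_sub, norm_smul]
      simp only [norm_neg, Complex.norm_I, one_mul]
      calc _ ≤ ‖K r‖ * ‖P x - P y‖ := norm_mul_le _ _
        _ ≤ M * (2 * ‖x - y‖) := by
          gcongr
          · exact hM r hr
          · exact lr_radial x y
        _ = _ := by simp [hM0]; ring
    · intro x _
      exact (hK.mul continuousOn_const).const_smul _
    · intro r hr x _
      simp only [F]
      rw [norm_smul]
      simp only [norm_neg, Complex.norm_I, one_mul]
      calc _ ≤ ‖K r‖ * ‖P x‖ := norm_mul_le _ _
        _ ≤ M * 1 := by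
          gcongr
          · exact hM r hr
          · exact hP1 x
        _ = _ := by simp [hM0]
    · simp [hM0, hst]
  obtain ⟨V, hV0, hV⟩ := hPL.exists_eq_forall_mem_Icc_hasDerivWithinAt₀
  simp only at hV0
  have hstar : ∀ r ∈ Set.Icc s t,
      HasDerivWithinAt (fun r => star (V r)) (Complex.I • (star (P (V r)) * K r))
        (Set.Icc s t) r := by
    intro r hr
    have := (hV r hr).star
    simp only [F] at this
    rwa [lr_starI, star_mul, hKs r hr] at this
  have hPc : ∀ x, ∃ c : ℝ, P x = c • x := fun x => ⟨_, rfl⟩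
  have h1 : ∀ r ∈ Set.Icc s t, star (V r) * V r - 1 = 0 := by
    apply lr_zero (K := 0) (f' := fun _ => 0)
    · intro r hr
      have := ((hstar r hr).mul (hV r hr)).sub_const 1
      refine HasDerivWithinAt.congr_deriv this ?_
      obtain ⟨c, hc⟩ := hPc (V r)
      simp only [F]
      rw [hc, star_smul]
      simp [mul_assoc]
    · simp [hV0]
    · simp
  have h1' : ∀ r ∈ Set.Icc s t, star (V r) * V r = 1 := fun r hr => sub_eq_zero.1 (h1 r hr)
  have hPV : ∀ r ∈ Set.Icc s t, P (V r) = V r := by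
    intro r hr
    have := lr_norm_le_one (h1' r hr)
    simp [P, max_eq_left this]
  have hV' : ∀ r ∈ Set.Icc s t,
      HasDerivWithinAt V ((-Complex.I) • (K r * V r)) (Set.Icc s t) r := by
    intro r hr
    have := hV r hr
    simp only [F] at this
    rwa [hPV r hr] at this
  refine ⟨V, hV0, hV', h1', ?_, ?_⟩
  · have : ∀ r ∈ Set.Icc s t, V r * star (V r) - 1 = 0 := by
      apply lr_zero (K := 2 * M) (f' := fun r => (-Complex.I) • (K r * (V r * star (V r) - 1)
        - (V r * star (V r) - 1) * K r))
      · intro r hr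
        have hs := hstar r hr
        rw [hPV r hr] at hs
        refine HasDerivWithinAt.congr_deriv (((hV' r hr).mul hs).sub_const 1) ?_
        simp only [mul_smul_comm, smul_mul_assoc, neg_smul, neg_mul, mul_sub, sub_mul, smul_sub, mul_one,
          one_mul, mul_assoc]
        abel
      · simp [hV0]
      · intro r hr
        rw [norm_smul]
        simp only [norm_neg, Complex.norm_I, one_mul]
        calc _ ≤ ‖K r‖ * ‖V r * star (V r) - 1‖ + ‖V r * star (V r) - 1‖ * ‖K r‖ :=
              (norm_sub_le _ _).trans (add_le_add (norm_mul_le _ _) (norm_mul_le _ _))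
          _ ≤ M * ‖V r * star (V r) - 1‖ + ‖V r * star (V r) - 1‖ * M := by
              gcongr <;> exact hM r hr
          _ = _ := by ring
    exact fun r hr => sub_eq_zero.1 (this r hr)
  · intro C hC
    have : ∀ r ∈ Set.Icc s t, V r * C - C * V r = 0 := by
      apply lr_zero (K := M) (f' := fun r => (-Complex.I) • (K r * (V r * C - C * V r)))
      · intro r hr
        refine HasDerivWithinAt.congr_deriv (((hV' r hr).mul_const C).sub ((hV' r hr).const_mul C)) ?_
        simp only [mul_smul_comm, smul_mul_assoc, mul_sub, smul_sub, mul_assoc]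
        rw [← mul_assoc C, ← hC r hr, mul_assoc]
      · simp [hV0]
      · intro r hr
        rw [norm_smul]
        simp only [norm_neg, Complex.norm_I, one_mul]
        exact (norm_mul_le _ _).trans (by gcongr; exact hM r hr)
    exact fun r hr => sub_eq_zero.1 (this r hr)

end helper_ode

section helper_key
variable {A : Type*} [NormedRing A] [StarRing A] [CStarRing A] [NormedAlgebra ℂ A]
  [CompleteSpace A] [StarModule ℂ A]

theorem lr_ftc {h : ℝ → ℝ} {s t : ℝ} (hh : ContinuousOn h (Set.Icc s t)) :
    ∀ r ∈ Set.Icc s t, HasDerivWithinAt (fun u => ∫ x in s..u, h x) (h r) (Set.Icc s t) r := by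
  intro r hr
  have : Fact (r ∈ Set.Icc s t) := ⟨hr⟩
  have hint : IntervalIntegrable h MeasureTheory.volume s r := by
    apply ContinuousOn.intervalIntegrable
    rw [Set.uIcc_of_le hr.1]
    exact hh.mono (Set.Icc_subset_Icc_right hr.2)
  exact intervalIntegral.integral_hasDerivWithinAt_right hint
    (hh.stronglyMeasurableAtFilter_nhdsWithin measurableSet_Icc r) (hh r hr)

theorem lr_norm_conj {w z : A} (hw : star w * w = 1) : ‖star w * z * w‖ ≤ ‖z‖ := by
  have h1 := lr_norm_le_one hw
  calc ‖star w * z * w‖ ≤ ‖star w‖ * ‖z‖ * ‖w‖ :=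
        (norm_mul_le _ _).trans (mul_le_mul_of_nonneg_right (norm_mul_le _ _) (norm_nonneg _))
    _ = ‖w‖ * ‖z‖ * ‖w‖ := by rw [norm_star]
    _ ≤ 1 * ‖z‖ * 1 := by gcongr
    _ = _ := by ring

theorem lr_norm_conj' {w z : A} (hw : star w * w = 1) : ‖w * z * star w‖ ≤ ‖z‖ := by
  have h1 := lr_norm_le_one hw
  calc ‖w * z * star w‖ ≤ ‖w‖ * ‖z‖ * ‖star w‖ :=
        (norm_mul_le _ _).trans (mul_le_mul_of_nonneg_right (norm_mul_le _ _) (norm_nonneg _))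
    _ = ‖w‖ * ‖z‖ * ‖w‖ := by rw [norm_star]
    _ ≤ 1 * ‖z‖ * 1 := by gcongr
    _ = _ := by ring

theorem lr_star_comm {v c : A} (h1 : star v * v = 1) (h2 : v * star v = 1)
    (h : v * c = c * v) : star v * c = c * star v := by
  calc star v * c = star v * (c * (v * star v)) := by rw [h2, mul_one]
    _ = star v * (c * v) * star v := by simp only [mul_assoc]
    _ = (star v * v) * c * star v := by rw [← h]; simp only [mul_assoc]
    _ = _ := by rw [h1, one_mul]

theorem lr_key {ι : Type*} {s t : ℝ} (hst : s ≤ t) (U H HX HO : ℝ → A) (S : Finset ι)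
    (φ : ι → ℝ → A)
    (hU0 : U s = 1)
    (hU1 : ∀ r ∈ Set.Icc s t, star (U r) * U r = 1)
    (hU2 : ∀ r ∈ Set.Icc s t, U r * star (U r) = 1)
    (hUd : ∀ r ∈ Set.Icc s t, HasDerivWithinAt U ((-Complex.I) • (H r * U r)) (Set.Icc s t) r)
    (hH : ∀ r ∈ Set.Icc s t, star (H r) = H r)
    (hHX : ∀ r ∈ Set.Icc s t, star (HX r) = HX r)
    (hHXc : ContinuousOn HX (Set.Icc s t))
    (hφ : ∀ Z ∈ S, ∀ r ∈ Set.Icc s t, star (φ Z r) = φ Z r)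
    (hφc : ∀ Z ∈ S, ContinuousOn (φ Z) (Set.Icc s t))
    (hdec : ∀ r ∈ Set.Icc s t, H r = HX r + HO r + ∑ Z ∈ S, φ Z r)
    (A₀ B : A)
    (hOA : ∀ r ∈ Set.Icc s t, HO r * A₀ = A₀ * HO r)
    (hOX : ∀ r ∈ Set.Icc s t, ∀ r' ∈ Set.Icc s t, HX r' * HO r = HO r * HX r') :
    ∃ A' : A, ‖A'‖ ≤ ‖A₀‖ ∧
      ((∀ r ∈ Set.Icc s t, HX r * B = B * HX r) → A₀ * B = B * A₀ → A' * B = B * A') ∧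
      ‖star (U t) * A₀ * U t * B - B * (star (U t) * A₀ * U t)‖ ≤
        ‖A' * B - B * A'‖ + 2 * ‖A₀‖ *
          ∫ r in s..t, ∑ Z ∈ S, ‖star (U r) * φ Z r * U r * B - B * (star (U r) * φ Z r * U r)‖ := by
  obtain ⟨V, hV0, hVd, hV1, hV2, hVC⟩ := lr_exists_unitary hst HX hHXc hHX
  have htm : t ∈ Set.Icc s t := ⟨hst, le_rfl⟩
  have hsm : s ∈ Set.Icc s t := ⟨le_rfl, hst⟩
  have hUc : ContinuousOn U (Set.Icc s t) := fun r hr => (hUd r hr).continuousWithinAt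
  set K : ℝ → A := fun r => star (U r) * (∑ Z ∈ S, φ Z r) * U r with hK
  have hKc : ContinuousOn K (Set.Icc s t) :=
    (hUc.star.mul (continuousOn_finsetSum _ hφc)).mul hUc
  have hKs : ∀ r ∈ Set.Icc s t, star (K r) = K r := by
    intro r hr
    simp only [hK, star_mul, star_star, star_sum]
    rw [Finset.sum_congr rfl (fun Z hZ => hφ Z hZ r hr), mul_assoc]
  obtain ⟨W, hW0, hWd, hW1, hW2, -⟩ := lr_exists_unitary hst (fun r => -K r) hKc.neg
    (fun r hr => by rw [star_neg, hKs r hr])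
  set A' : A := star (V t) * A₀ * V t with hA'
  have hA'n : ‖A'‖ ≤ ‖A₀‖ := lr_norm_conj (hV1 t htm)
  set D : ℝ → A := fun r => HO r + ∑ Z ∈ S, φ Z r with hD
  have hDH : ∀ r ∈ Set.Icc s t, HX r + D r = H r := by
    intro r hr
    rw [hdec r hr, hD]; simp only [add_assoc]
  have hDs : ∀ r ∈ Set.Icc s t, star (D r) = D r := by
    intro r hr
    have e : D r = H r - HX r := by rw [← hDH r hr]; abel
    rw [e, star_sub, hH r hr, hHX r hr]
  -- derivative of Y = V* U
  set Y : ℝ → A := fun r => star (V r) * U r with hY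
  have hYd : ∀ r ∈ Set.Icc s t,
      HasDerivWithinAt Y ((-Complex.I) • (star (V r) * D r * U r)) (Set.Icc s t) r := by
    intro r hr
    have h1 := (hVd r hr).star
    rw [lr_starI, star_mul, hHX r hr] at h1
    refine HasDerivWithinAt.congr_deriv (h1.mul (hUd r hr)) ?_
    rw [← hDH r hr]
    simp only [mul_smul_comm, smul_mul_assoc, neg_smul, neg_mul, mul_neg, mul_add, add_mul,
      smul_add, mul_assoc]
    abel
  have hYsd : ∀ r ∈ Set.Icc s t,
      HasDerivWithinAt (fun r => star (Y r)) (Complex.I • (star (U r) * D r * V r))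
        (Set.Icc s t) r := by
    intro r hr
    have h1 := (hYd r hr).star
    rw [lr_starI, star_mul, star_mul, star_star, hDs r hr, ← mul_assoc] at h1
    exact h1
  set Q : ℝ → A := fun r => star (Y r) * A' * Y r with hQ
  have hQe : ∀ r, Q r = star (U r) * (V r * A' * star (V r)) * U r := by
    intro r
    simp only [hQ, hY, star_mul, star_star, mul_assoc]
  have hQn : ∀ r ∈ Set.Icc s t, ‖Q r‖ ≤ ‖A₀‖ := by
    intro r hr
    rw [hQe]
    exact (lr_norm_conj (hU1 r hr)).trans ((lr_norm_conj' (hV1 r hr)).trans hA'n)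
  have hOM : ∀ r ∈ Set.Icc s t,
      HO r * (V r * A' * star (V r)) = (V r * A' * star (V r)) * HO r := by
    intro r hr
    have c1 : ∀ r' ∈ Set.Icc s t, Commute (V r') (HO r) :=
      fun r' hr' => hVC (HO r) (hOX r hr) r' hr'
    have c2 : ∀ r' ∈ Set.Icc s t, Commute (star (V r')) (HO r) :=
      fun r' hr' => lr_star_comm (hV1 r' hr') (hV2 r' hr') (c1 r' hr')
    have c3 : Commute A₀ (HO r) := (hOA r hr).symm
    have c4 : Commute A' (HO r) := ((c2 t htm).mul_left c3).mul_left (c1 t htm)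
    exact ((((c1 r hr).mul_left c4).mul_left (c2 r hr)).eq).symm
  have hQd : ∀ r ∈ Set.Icc s t,
      HasDerivWithinAt Q (Complex.I • (K r * Q r - Q r * K r)) (Set.Icc s t) r := by
    intro r hr
    refine HasDerivWithinAt.congr_deriv (((hYsd r hr).mul_const A').mul (hYd r hr)) ?_
    set M : A := V r * A' * star (V r) with hM
    set Sg : A := ∑ Z ∈ S, φ Z r with hSg
    have e1 : K r * Q r = star (U r) * (Sg * M) * U r := by
      rw [hQe]
      calc star (U r) * Sg * U r * (star (U r) * M * U r)
          = star (U r) * Sg * (U r * star (U r)) * M * U r := by simp only [mul_assoc]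
        _ = _ := by rw [hU2 r hr, mul_one]; simp only [mul_assoc]
    have e2 : Q r * K r = star (U r) * (M * Sg) * U r := by
      rw [hQe]
      calc star (U r) * M * U r * (star (U r) * Sg * U r)
          = star (U r) * M * (U r * star (U r)) * Sg * U r := by simp only [mul_assoc]
        _ = _ := by rw [hU2 r hr, mul_one]; simp only [mul_assoc]
    have e3 : D r * M - M * D r = Sg * M - M * Sg := by
      simp only [hD]
      rw [add_mul, mul_add, hOM r hr]; abel
    rw [e1, e2, ← sub_mul, ← mul_sub, ← e3]
    simp only [hM, hY, star_mul, star_star, mul_smul_comm, smul_mul_assoc, neg_smul, neg_mul,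
      mul_neg, mul_sub, sub_mul, smul_sub, mul_assoc]
    abel
  set f : ℝ → A := fun r => Q r * B - B * Q r with hf
  have hfd : ∀ r ∈ Set.Icc s t, HasDerivWithinAt f
      (Complex.I • ((K r * Q r - Q r * K r) * B - B * (K r * Q r - Q r * K r)))
      (Set.Icc s t) r := by
    intro r hr
    refine HasDerivWithinAt.congr_deriv
      (((hQd r hr).mul_const B).sub ((hQd r hr).const_mul B)) ?_
    simp only [mul_smul_comm, smul_mul_assoc, smul_sub, mul_sub, sub_mul]
  set F : ℝ → A := fun r => star (W r) * f r * W r with hF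
  have hFd : ∀ r ∈ Set.Icc s t, HasDerivWithinAt F
      (Complex.I • (star (W r) * ((K r * B - B * K r) * Q r - Q r * (K r * B - B * K r)) * W r))
      (Set.Icc s t) r := by
    intro r hr
    have h1 := (hWd r hr).star
    rw [lr_starI, star_mul, star_neg, hKs r hr] at h1
    refine HasDerivWithinAt.congr_deriv ((h1.mul (hfd r hr)).mul (hWd r hr)) ?_
    simp only [hf, mul_smul_comm, smul_mul_assoc, neg_smul, neg_mul, mul_neg, mul_sub, sub_mul,
      smul_sub, smul_neg, mul_assoc, neg_neg, Pi.mul_apply, smul_add, add_mul, mul_add]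
    abel
  set h : ℝ → ℝ := fun r => ∑ Z ∈ S,
    ‖star (U r) * φ Z r * U r * B - B * (star (U r) * φ Z r * U r)‖ with hh
  have hhc : ContinuousOn h (Set.Icc s t) := by
    apply continuousOn_finsetSum
    intro Z hZ
    have hc1 : ContinuousOn (fun r => star (U r) * φ Z r * U r) (Set.Icc s t) :=
      (hUc.star.mul (hφc Z hZ)).mul hUc
    exact ((hc1.mul continuousOn_const).sub (continuousOn_const.mul hc1)).norm
  have hKB : ∀ r, ‖K r * B - B * K r‖ ≤ h r := by
    intro r
    have : K r * B - B * K r = ∑ Z ∈ S,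
        (star (U r) * φ Z r * U r * B - B * (star (U r) * φ Z r * U r)) := by
      simp only [hK, Finset.mul_sum, Finset.sum_mul, Finset.sum_sub_distrib]
    rw [this]
    exact norm_sum_le _ _
  have hbd : ∀ r ∈ Set.Icc s t, ‖Complex.I • (star (W r) *
      ((K r * B - B * K r) * Q r - Q r * (K r * B - B * K r)) * W r)‖ ≤ 2 * ‖A₀‖ * h r := by
    intro r hr
    rw [norm_smul, Complex.norm_I, one_mul]
    refine (lr_norm_conj (hW1 r hr)).trans ?_
    have hh0 : 0 ≤ h r := (norm_nonneg _).trans (hKB r)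
    calc _ ≤ ‖K r * B - B * K r‖ * ‖Q r‖ + ‖Q r‖ * ‖K r * B - B * K r‖ :=
          (norm_sub_le _ _).trans (add_le_add (norm_mul_le _ _) (norm_mul_le _ _))
      _ ≤ h r * ‖A₀‖ + ‖A₀‖ * h r := by
          gcongr
          · exact hKB r
          · exact hQn r hr
          · exact hQn r hr
          · exact hKB r
      _ = _ := by ring
  have hB : ∀ r ∈ Set.Icc s t, HasDerivWithinAt
      (fun u => ‖A' * B - B * A'‖ + 2 * ‖A₀‖ * ∫ x in s..u, h x) (2 * ‖A₀‖ * h r)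
      (Set.Icc s t) r := by
    intro r hr
    exact ((lr_ftc hhc r hr).const_mul (2 * ‖A₀‖)).const_add _
  have hfin := image_norm_le_of_norm_deriv_right_le_deriv_boundary'
    (f := F) (a := s) (b := t)
    (f' := fun r => Complex.I • (star (W r) *
      ((K r * B - B * K r) * Q r - Q r * (K r * B - B * K r)) * W r))
    (B := fun u => ‖A' * B - B * A'‖ + 2 * ‖A₀‖ * ∫ x in s..u, h x)
    (B' := fun r => 2 * ‖A₀‖ * h r)
    (fun r hr => (hFd r hr).continuousWithinAt)
    (fun r hr => lr_ici (hFd r (Set.Ico_subset_Icc_self hr)) hr)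
    (by simp [hF, hf, hQe, hW0, hU0, hV0])
    (fun r hr => (hB r hr).continuousWithinAt)
    (fun r hr => lr_ici (hB r (Set.Ico_subset_Icc_self hr)) hr)
    (fun r hr => hbd r (Set.Ico_subset_Icc_self hr)) htm
  refine ⟨A', hA'n, ?_, ?_⟩
  · intro hXB hAB
    have c1 : Commute (V t) B := hVC B hXB t htm
    have c2 : Commute (star (V t)) B := lr_star_comm (hV1 t htm) (hV2 t htm) c1
    have c3 : Commute A₀ B := hAB
    exact ((c2.mul_left c3).mul_left c1).eq
  · have hQt : Q t = star (U t) * A₀ * U t := by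
      rw [hQe]
      have : V t * A' * star (V t) = A₀ := by
        calc V t * (star (V t) * A₀ * V t) * star (V t)
            = (V t * star (V t)) * A₀ * (V t * star (V t)) := by simp only [mul_assoc]
          _ = A₀ := by rw [hV2 t htm, one_mul, mul_one]
      rw [this]
    rw [← hQt]
    have hfW : f t = W t * F t * star (W t) := by
      calc f t = (W t * star (W t)) * f t * (W t * star (W t)) := by
            rw [hW2 t htm, one_mul, mul_one]
        _ = _ := by simp only [hF, mul_assoc]
    calc ‖Q t * B - B * Q t‖ = ‖f t‖ := rfl
      _ ≤ ‖F t‖ := by rw [hfW]; exact lr_norm_conj' (hW1 t htm)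
      _ ≤ _ := hfin
end helper_key

section helper_sys

theorem lr_system {Γ : Type*} {s t : ℝ} (hst : s ≤ t) (Λ : Finset Γ) (G : Γ → Γ → ℝ)
    (hG : ∀ x y, 0 ≤ G x y) (n : ℝ → ℝ) (hn : ContinuousOn n (Set.Icc s t))
    (hn0 : ∀ r ∈ Set.Icc s t, 0 ≤ n r) (E : Γ → ℝ → ℝ)
    (hE : ∀ w ∈ Λ, ContinuousOn (E w) (Set.Icc s t)) (gY : Γ → ℝ) (b : ℝ)
    (hb : 0 ≤ b)
    (hsys : ∀ w ∈ Λ, ∀ r ∈ Set.Icc s t,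
      E w r ≤ 2 * n r * (b * gY w + ∑ z ∈ Λ, G w z * ∫ x in s..r, E z x))
    (hconv : ∀ w ∈ Λ, ∑ z ∈ Λ, G w z * gY z ≤ gY w) :
    ∀ w ∈ Λ, ∀ r ∈ Set.Icc s t,
      ∫ x in s..r, E w x ≤ b * (Real.exp (2 * ∫ x in s..r, n x) - 1) * gY w := by
  set e : Γ → ℝ → ℝ := fun w r => ∫ x in s..r, E w x with he
  set J : Γ → ℝ → ℝ := fun w r => b * (Real.exp (2 * ∫ x in s..r, n x) - 1) * gY w with hJ
  set J' : Γ → ℝ → ℝ := fun w r => 2 * n r * (b * Real.exp (2 * ∫ x in s..r, n x) * gY w) with hJ'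
  have hJd : ∀ w, ∀ r ∈ Set.Icc s t, HasDerivWithinAt (J w) (J' w r) (Set.Icc s t) r := by
    intro w r hr
    have h1 := ((lr_ftc hn r hr).const_mul 2).exp
    refine HasDerivWithinAt.congr_deriv (((h1.sub_const 1).const_mul b).mul_const (gY w)) ?_
    simp only [hJ']; ring
  have hδd : ∀ w ∈ Λ, ∀ r ∈ Set.Icc s t,
      HasDerivWithinAt (fun r => e w r - J w r) (E w r - J' w r) (Set.Icc s t) r :=
    fun w hw r hr => (lr_ftc (hE w hw) r hr).sub (hJd w r hr)
  set φ : ℝ → ℝ := fun r => ∑ w ∈ Λ, max (e w r - J w r) 0 with hφ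
  have hφc : ContinuousOn φ (Set.Icc s t) := by
    apply continuousOn_finsetSum
    intro w hw
    have : ContinuousOn (fun r => e w r - J w r) (Set.Icc s t) :=
      fun r hr => (hδd w hw r hr).continuousWithinAt
    exact this.sup continuousOn_const
  have hφ0 : ∀ r, 0 ≤ φ r := fun r => Finset.sum_nonneg (fun w _ => le_max_right _ _)
  obtain ⟨C1, hC1⟩ := isCompact_Icc.exists_bound_of_continuousOn hn
  set C2 : ℝ := ∑ w ∈ Λ, ∑ z ∈ Λ, G w z with hC2
  have hC20 : 0 ≤ C2 := Finset.sum_nonneg (fun w _ => Finset.sum_nonneg (fun z _ => hG w z))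
  have hC10 : 0 ≤ C1 := (norm_nonneg _).trans (hC1 s ⟨le_rfl, hst⟩)
  set C : ℝ := 2 * C1 * C2 with hC
  have hbound : ∀ w ∈ Λ, ∀ r ∈ Set.Icc s t, E w r - J' w r ≤ C * φ r := by
    intro w hw r hr
    have hnr := hn0 r hr
    set X : ℝ := Real.exp (2 * ∫ x in s..r, n x) with hX
    have hX1 : 1 ≤ X := by
      apply Real.one_le_exp
      have : 0 ≤ ∫ x in s..r, n x :=
        intervalIntegral.integral_nonneg hr.1 (fun u hu => hn0 u ⟨hu.1, hu.2.trans hr.2⟩)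
      linarith
    have h1 : ∑ z ∈ Λ, G w z * J z r ≤ b * (X - 1) * gY w := by
      have : ∑ z ∈ Λ, G w z * J z r = b * (X - 1) * ∑ z ∈ Λ, G w z * gY z := by
        rw [Finset.mul_sum]
        exact Finset.sum_congr rfl (fun z _ => by simp only [hJ]; ring)
      rw [this]
      exact mul_le_mul_of_nonneg_left (hconv w hw) (mul_nonneg hb (by linarith))
    have h2 : ∑ z ∈ Λ, G w z * (e z r - J z r) ≤ C2 * φ r := by
      calc ∑ z ∈ Λ, G w z * (e z r - J z r) ≤ ∑ z ∈ Λ, C2 * max (e z r - J z r) 0 := by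
            apply Finset.sum_le_sum
            intro z hz
            have hGC : G w z ≤ C2 := by
              calc G w z ≤ ∑ z ∈ Λ, G w z := Finset.single_le_sum (fun z _ => hG w z) hz
                _ ≤ C2 := Finset.single_le_sum (f := fun w => ∑ z ∈ Λ, G w z)
                    (fun w _ => Finset.sum_nonneg (fun z _ => hG w z)) hw
            calc G w z * (e z r - J z r) ≤ G w z * max (e z r - J z r) 0 :=
                  mul_le_mul_of_nonneg_left (le_max_left _ _) (hG w z)
              _ ≤ _ := mul_le_mul_of_nonneg_right hGC (le_max_right _ _)
        _ = _ := by rw [hφ, Finset.mul_sum]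
    have h3 : ∑ z ∈ Λ, G w z * e z r ≤ C2 * φ r + b * (X - 1) * gY w := by
      have : ∑ z ∈ Λ, G w z * e z r =
          ∑ z ∈ Λ, G w z * (e z r - J z r) + ∑ z ∈ Λ, G w z * J z r := by
        rw [← Finset.sum_add_distrib]
        exact Finset.sum_congr rfl (fun z _ => by ring)
      linarith
    have h4 : E w r ≤ 2 * n r * (C2 * φ r) + J' w r := by
      calc E w r ≤ 2 * n r * (b * gY w + ∑ z ∈ Λ, G w z * e z r) := hsys w hw r hr
        _ ≤ 2 * n r * (b * gY w + (C2 * φ r + b * (X - 1) * gY w)) := by gcongr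
        _ = _ := by simp only [hJ']; ring
    have h5 : n r ≤ C1 := (le_abs_self _).trans (hC1 r hr)
    have h6 : 2 * n r * (C2 * φ r) ≤ 2 * C1 * (C2 * φ r) := by
      have := mul_nonneg hC20 (hφ0 r)
      gcongr
    have h7 : C * φ r = 2 * C1 * (C2 * φ r) := by rw [hC]; ring
    linarith
  set P : ℝ → ℝ := fun r => ∫ x in s..r, φ x with hP
  have hδ : ∀ w ∈ Λ, ∀ r ∈ Set.Icc s t, e w r - J w r ≤ C * P r := by
    intro w hw r hr
    have hCd : ∀ r ∈ Set.Icc s t, HasDerivWithinAt (fun r => C * P r) (C * φ r)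
        (Set.Icc s t) r := fun r hr => (lr_ftc hφc r hr).const_mul C
    exact image_le_of_deriv_right_le_deriv_boundary
      (f := fun r => e w r - J w r) (f' := fun r => E w r - J' w r)
      (B := fun r => C * P r) (B' := fun r => C * φ r)
      (fun r hr => (hδd w hw r hr).continuousWithinAt)
      (fun r hr => lr_ici (hδd w hw r (Set.Ico_subset_Icc_self hr)) hr)
      (by simp [he, hJ, hP])
      (fun r hr => (hCd r hr).continuousWithinAt)
      (fun r hr => lr_ici (hCd r (Set.Ico_subset_Icc_self hr)) hr)
      (fun r hr => hbound w hw r (Set.Ico_subset_Icc_self hr)) hr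
  have hP0 : ∀ r ∈ Set.Icc s t, 0 ≤ P r :=
    fun r hr => intervalIntegral.integral_nonneg hr.1 (fun u _ => hφ0 u)
  have hC0 : 0 ≤ C := by positivity
  have hPz : ∀ r ∈ Set.Icc s t, P r = 0 := by
    apply lr_zero (f' := φ) (K := Λ.card * C)
    · exact fun r hr => lr_ftc hφc r hr
    · simp [hP]
    · intro r hr
      rw [Real.norm_of_nonneg (hφ0 r), Real.norm_of_nonneg (hP0 r hr)]
      calc φ r ≤ ∑ w ∈ Λ, C * P r := Finset.sum_le_sum
            (fun w hw => max_le (hδ w hw r hr) (mul_nonneg hC0 (hP0 r hr)))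
        _ = _ := by rw [Finset.sum_const, nsmul_eq_mul]; ring
  intro w hw r hr
  have := hδ w hw r hr
  rw [hPz r hr, mul_zero] at this
  exact sub_nonpos.1 this

end helper_sys

section helper_main
variable {Γ A : Type*} [NormedRing A] [StarRing A] [CStarRing A] [NormedAlgebra ℂ A]
  [CompleteSpace A] [StarModule ℂ A]

theorem lr_step {a : Γ → A} (hCAR : IsCAR a) {s t : ℝ} (hst : s ≤ t)
    (Φ : Finset Γ → ℝ → A)
    (hΦsa : ∀ Z : Finset Γ, ∀ r ∈ Set.Icc s t, star (Φ Z r) = Φ Z r)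
    (hΦeven : ∀ Z : Finset Γ, ∀ r ∈ Set.Icc s t, Φ Z r ∈ carSpanEven a Z)
    (hΦcont : ∀ Z : Finset Γ, ContinuousOn (Φ Z) (Set.Icc s t))
    (Λ : Finset Γ) (U : ℝ → A) (hU0 : U s = 1)
    (hU1 : ∀ r ∈ Set.Icc s t, star (U r) * U r = 1)
    (hU2 : ∀ r ∈ Set.Icc s t, U r * star (U r) = 1)
    (hUd : ∀ r ∈ Set.Icc s t, HasDerivWithinAt U
      ((-Complex.I) • ((∑ Z ∈ Λ.powerset, Φ Z r) * U r)) (Set.Icc s t) r)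
    (X Y : Finset Γ) (A₀ B : A) (hA : A₀ ∈ carSpan a X) (hB : B ∈ carSpan a Y) :
    (Disjoint X Y → A₀ * B = B * A₀ →
      ‖star (U t) * A₀ * U t * B - B * (star (U t) * A₀ * U t)‖ ≤
        2 * ‖A₀‖ * ∫ r in s..t, ∑ Z ∈ Λ.powerset with ¬ Z ⊆ X ∧ ¬ Disjoint Z X,
          ‖star (U r) * Φ Z r * U r * B - B * (star (U r) * Φ Z r * U r)‖) ∧
    (‖star (U t) * A₀ * U t * B - B * (star (U t) * A₀ * U t)‖ ≤ 2 * ‖A₀‖ * ‖B‖ +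
        2 * ‖A₀‖ * ∫ r in s..t, ∑ Z ∈ Λ.powerset with ¬ Z ⊆ X ∧ ¬ Disjoint Z X,
          ‖star (U r) * Φ Z r * U r * B - B * (star (U r) * Φ Z r * U r)‖) := by
  obtain ⟨A', h1, h2, h3⟩ := lr_key hst U (fun r => ∑ Z ∈ Λ.powerset, Φ Z r)
    (fun r => ∑ Z ∈ Λ.powerset with Z ⊆ X, Φ Z r)
    (fun r => ∑ Z ∈ Λ.powerset with ¬ Z ⊆ X ∧ Disjoint Z X, Φ Z r)
    (Λ.powerset.filter (fun Z => ¬ Z ⊆ X ∧ ¬ Disjoint Z X)) Φ hU0 hU1 hU2 hUd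
    (fun r hr => by rw [star_sum]; exact Finset.sum_congr rfl (fun Z _ => hΦsa Z r hr))
    (fun r hr => by rw [star_sum]; exact Finset.sum_congr rfl (fun Z _ => hΦsa Z r hr))
    (continuousOn_finsetSum _ (fun Z _ => hΦcont Z))
    (fun Z _ r hr => hΦsa Z r hr) (fun Z _ => hΦcont Z)
    (fun r _ => by
      rw [← Finset.sum_filter_add_sum_filter_not Λ.powerset (fun Z => Z ⊆ X), add_assoc]
      congr 1
      rw [← Finset.sum_filter_add_sum_filter_not (Λ.powerset.filter (fun Z => ¬ Z ⊆ X))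
        (fun Z => Disjoint Z X), Finset.filter_filter, Finset.filter_filter])
    A₀ B
    (fun r hr => by
      refine (Commute.sum_left _ _ _ ?_).eq
      intro Z hZ
      simp only [Finset.mem_filter] at hZ
      exact lr_even_comm hCAR hZ.2.2 (hΦeven Z r hr) hA)
    (fun r hr r' hr' => by
      refine (Commute.sum_left _ _ _ ?_).eq
      intro Z hZ
      refine Commute.sum_right _ _ _ ?_
      intro Z' hZ'
      simp only [Finset.mem_filter] at hZ hZ'
      exact lr_even_comm hCAR (Finset.disjoint_of_subset_left hZ.2 hZ'.2.2.symm)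
        (hΦeven Z r' hr') (lr_even_le a Z' (hΦeven Z' r hr)))
  refine ⟨?_, ?_⟩
  · intro hd hAB
    have hc := h2 (fun r hr => by
      refine (Commute.sum_left _ _ _ ?_).eq
      intro Z hZ
      simp only [Finset.mem_filter] at hZ
      exact lr_even_comm hCAR (Finset.disjoint_of_subset_left hZ.2 hd) (hΦeven Z r hr) hB) hAB
    rw [hc, sub_self, norm_zero, zero_add] at h3
    exact h3
  · refine h3.trans ?_
    gcongr
    calc ‖A' * B - B * A'‖ ≤ ‖A'‖ * ‖B‖ + ‖B‖ * ‖A'‖ :=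
          (norm_sub_le _ _).trans (add_le_add (norm_mul_le _ _) (norm_mul_le _ _))
      _ ≤ ‖A₀‖ * ‖B‖ + ‖B‖ * ‖A₀‖ := by gcongr
      _ = _ := by ring

theorem lr_count (pow S : Finset (Finset Γ)) (hS : S ⊆ pow) (T : Finset Γ)
    (d : Finset Γ → ℝ) (hd : ∀ Z, 0 ≤ d Z) (h : ∀ Z ∈ S, d Z = 0 ∨ ∃ x ∈ T, x ∈ Z) :
    ∑ Z ∈ S, d Z ≤ ∑ x ∈ T, ∑ Z ∈ pow, if x ∈ Z then d Z else 0 := by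
  rw [Finset.sum_comm]
  have hnn : ∀ Z, ∀ x, 0 ≤ (if x ∈ Z then d Z else 0) := by
    intro Z x
    split_ifs
    · exact hd Z
    · exact le_rfl
  calc ∑ Z ∈ S, d Z ≤ ∑ Z ∈ S, ∑ x ∈ T, if x ∈ Z then d Z else 0 := by
        apply Finset.sum_le_sum
        intro Z hZ
        rcases h Z hZ with h0 | ⟨x, hx, hxZ⟩
        · rw [h0]; simp
        · calc d Z = if x ∈ Z then d Z else 0 := by rw [if_pos hxZ]
            _ ≤ _ := Finset.single_le_sum (f := fun x => if x ∈ Z then d Z else 0)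
              (fun x _ => hnn Z x) hx
    _ ≤ _ := Finset.sum_le_sum_of_subset_of_nonneg hS
        (fun Z _ _ => Finset.sum_nonneg (fun x _ => hnn Z x))

theorem lr_main {a : Γ → A} (hCAR : IsCAR a) {s t : ℝ} (hst : s ≤ t)
    (Φ : Finset Γ → ℝ → A)
    (hΦsa : ∀ Z : Finset Γ, ∀ r ∈ Set.Icc s t, star (Φ Z r) = Φ Z r)
    (hΦeven : ∀ Z : Finset Γ, ∀ r ∈ Set.Icc s t, Φ Z r ∈ carSpanEven a Z)
    (hΦcont : ∀ Z : Finset Γ, ContinuousOn (Φ Z) (Set.Icc s t))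
    (Λ : Finset Γ) (hΛ : Λ.Nonempty) (U : ℝ → A) (hU0 : U s = 1)
    (hU1 : ∀ r ∈ Set.Icc s t, star (U r) * U r = 1)
    (hU2 : ∀ r ∈ Set.Icc s t, U r * star (U r) = 1)
    (hUd : ∀ r ∈ Set.Icc s t, HasDerivWithinAt U
      ((-Complex.I) • ((∑ Z ∈ Λ.powerset, Φ Z r) * U r)) (Set.Icc s t) r)
    (G : Γ → Γ → ℝ) (hGpos : ∀ x y, 0 < G x y)
    (hGconv : ∀ x y, Summable (fun z => G x z * G z y) ∧ ∑' z, G x z * G z y ≤ G x y)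
    (nΦ : ℝ → ℝ)
    (hnΦint : IntervalIntegrable nΦ MeasureTheory.volume s t)
    (hΦG : ∀ x y : Γ, ∀ r ∈ Set.Icc s t,
      Summable (fun Z : {Z : Finset Γ // x ∈ Z ∧ y ∈ Z} => ‖Φ Z.1 r‖) ∧
      ∑' Z : {Z : Finset Γ // x ∈ Z ∧ y ∈ Z}, ‖Φ Z.1 r‖ ≤ nΦ r * G x y)
    (X Y : Finset Γ) (hXΛ : X ⊆ Λ) (hYΛ : Y ⊆ Λ) (hXY : Disjoint X Y)
    (A₀ B : A) (hA : A₀ ∈ carSpan a X) (hB : B ∈ carSpan a Y) (hcomm : A₀ * B = B * A₀)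
    (T : Finset Γ) (hTX : T ⊆ X)
    (hT : ∀ Z : Finset Γ, ∀ r ∈ Set.Icc s t, ∀ x ∈ X, x ∈ Z → ¬ Z ⊆ X → Φ Z r ≠ 0 → x ∈ T) :
    ‖star (U t) * A₀ * U t * B - B * (star (U t) * A₀ * U t)‖ ≤
      2 * ‖A₀‖ * ‖B‖ * (Real.exp (2 * ∫ r in s..t, nΦ r) - 1) * ∑ x ∈ T, ∑ y ∈ Y, G x y := by
  have htm : t ∈ Set.Icc s t := ⟨hst, le_rfl⟩
  have hUc : ContinuousOn U (Set.Icc s t) := fun r hr => (hUd r hr).continuousWithinAt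
  set D : Finset Γ → ℝ → ℝ := fun Z r =>
    ‖star (U r) * Φ Z r * U r * B - B * (star (U r) * Φ Z r * U r)‖ with hD
  have hDc : ∀ Z, ContinuousOn (D Z) (Set.Icc s t) := by
    intro Z
    have hc1 : ContinuousOn (fun r => star (U r) * Φ Z r * U r) (Set.Icc s t) :=
      (hUc.star.mul (hΦcont Z)).mul hUc
    exact ((hc1.mul continuousOn_const).sub (continuousOn_const.mul hc1)).norm
  have hD0 : ∀ Z r, 0 ≤ D Z r := fun Z r => norm_nonneg _
  set E : Γ → ℝ → ℝ := fun w r => ∑ Z ∈ Λ.powerset, if w ∈ Z then D Z r else 0 with hE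
  have hEc : ∀ w, ContinuousOn (E w) (Set.Icc s t) := by
    intro w
    apply continuousOn_finsetSum
    intro Z _
    by_cases hw : w ∈ Z
    · simp only [hw, if_true]; exact hDc Z
    · simp only [hw, if_false]; exact continuousOn_const
  have hE0 : ∀ w r, 0 ≤ E w r := by
    intro w r
    apply Finset.sum_nonneg
    intro Z _
    split_ifs
    · exact hD0 Z r
    · exact le_rfl
  -- the integral of a boundary sum
  have hint : ∀ (S : Finset (Finset Γ)) (T : Finset Γ), S ⊆ Λ.powerset → ∀ u ∈ Set.Icc s t,
      (∀ r ∈ Set.Icc s t, ∀ Z ∈ S, D Z r = 0 ∨ ∃ x ∈ T, x ∈ Z) →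
      ∫ r in s..u, ∑ Z ∈ S, D Z r ≤ ∑ x ∈ T, ∫ r in s..u, E x r := by
    intro S T hS u hu hh
    have hsub : Set.uIcc s u ⊆ Set.Icc s t := by
      rw [Set.uIcc_of_le hu.1]; exact Set.Icc_subset_Icc_right hu.2
    rw [← intervalIntegral.integral_finsetSum]
    · apply intervalIntegral.integral_mono_on hu.1
      · exact (continuousOn_finsetSum _ (fun Z _ => (hDc Z).mono hsub)).intervalIntegrable
      · exact (continuousOn_finsetSum _ (fun Z _ => (hEc Z).mono hsub)).intervalIntegrable
      · intro r hr
        exact lr_count _ S hS T (fun Z => D Z r) (fun Z => hD0 Z r)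
          (hh r ⟨hr.1, hr.2.trans hu.2⟩)
    · intro x _
      exact ((hEc x).mono hsub).intervalIntegrable
  -- the continuous local interaction norm
  set σ : Γ → Γ → ℝ → ℝ := fun x y r =>
    ∑ Z ∈ Λ.powerset, if x ∈ Z ∧ y ∈ Z then ‖Φ Z r‖ else 0 with hσ
  have hσc : ∀ x y, ContinuousOn (σ x y) (Set.Icc s t) := by
    intro x y
    apply continuousOn_finsetSum
    intro Z _
    by_cases hw : x ∈ Z ∧ y ∈ Z
    · simp only [hw, if_true]; exact (hΦcont Z).norm
    · simp only [hw, if_false]; exact continuousOn_const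
  have hσ0 : ∀ x y r, 0 ≤ σ x y r := by
    intro x y r
    apply Finset.sum_nonneg
    intro Z _
    split_ifs
    · exact norm_nonneg _
    · exact le_rfl
  have hσle : ∀ x y, ∀ r ∈ Set.Icc s t, σ x y r ≤ nΦ r * G x y := by
    intro x y r hr
    obtain ⟨h1, h2⟩ := hΦG x y r hr
    refine le_trans ?_ h2
    simp only [hσ]
    rw [← Finset.sum_filter, ← Finset.sum_subtype_eq_sum_filter]
    exact h1.sum_le_tsum _ (fun _ _ => norm_nonneg _)
  have hne : (Λ ×ˢ Λ).Nonempty := hΛ.product hΛ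
  set n : ℝ → ℝ := fun r => (Λ ×ˢ Λ).sup' hne (fun p => σ p.1 p.2 r / G p.1 p.2) with hn
  have hnc : ContinuousOn n (Set.Icc s t) := by
    apply ContinuousOn.finset_sup'_apply
    intro p _
    exact (hσc p.1 p.2).div_const _
  have hσn : ∀ x ∈ Λ, ∀ y ∈ Λ, ∀ r, σ x y r ≤ n r * G x y := by
    intro x hx y hy r
    rw [← div_le_iff₀ (hGpos x y)]
    exact Finset.le_sup' (fun p : Γ × Γ => σ p.1 p.2 r / G p.1 p.2)
      (Finset.mk_mem_product hx hy)
  have hn0 : ∀ r, 0 ≤ n r := by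
    intro r
    obtain ⟨x, hx⟩ := hΛ
    have h1 := (hσ0 x x r).trans (hσn x hx x hx r)
    exact nonneg_of_mul_nonneg_left h1 (hGpos x x)
  have hnle : ∀ r ∈ Set.Icc s t, n r ≤ nΦ r := by
    intro r hr
    apply Finset.sup'_le
    intro p _
    rw [div_le_iff₀ (hGpos _ _)]
    exact hσle _ _ r hr
  set gY : Γ → ℝ := fun w => ∑ y ∈ Y, G w y with hgY
  have hstep := fun (u : ℝ) (hu : u ∈ Set.Icc s t) =>
    have hsub : Set.Icc s u ⊆ Set.Icc s t := Set.Icc_subset_Icc_right hu.2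
    lr_step hCAR hu.1 Φ (fun Z r hr => hΦsa Z r (hsub hr)) (fun Z r hr => hΦeven Z r (hsub hr))
      (fun Z => (hΦcont Z).mono hsub) Λ U hU0 (fun r hr => hU1 r (hsub hr))
      (fun r hr => hU2 r (hsub hr)) (fun r hr => (hUd r (hsub hr)).mono hsub)
  -- bound on D
  have hDb : ∀ Z ∈ Λ.powerset, ∀ r ∈ Set.Icc s t, D Z r ≤ 2 * ‖Φ Z r‖ *
      (‖B‖ * (∑ y ∈ Y, if y ∈ Z then 1 else 0) +
        ∑ z ∈ Λ, if z ∈ Z then (∫ x in s..r, E z x) else 0) := by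
    intro Z hZ r hr
    obtain ⟨h1, h2⟩ := hstep r hr Z Y (Φ Z r) B (lr_even_le a Z (hΦeven Z r hr)) hB
    have h3 : (∫ u in s..r, ∑ Z' ∈ Λ.powerset with ¬ Z' ⊆ Z ∧ ¬ Disjoint Z' Z, D Z' u) ≤
        ∑ z ∈ Λ, if z ∈ Z then (∫ x in s..r, E z x) else 0 := by
      rw [← Finset.sum_filter]
      have hf : Λ.filter (fun z => z ∈ Z) = Z := by
        ext z
        simp only [Finset.mem_filter]
        exact ⟨fun h => h.2, fun h => ⟨Finset.mem_powerset.1 hZ h, h⟩⟩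
      rw [hf]
      apply hint _ _ (Finset.filter_subset _ _) r hr
      intro u _ Z' hZ'
      right
      simp only [Finset.mem_filter] at hZ'
      obtain ⟨x, hx1, hx2⟩ := Finset.not_disjoint_iff.1 hZ'.2.2
      exact ⟨x, hx2, hx1⟩
    by_cases hd : Disjoint Z Y
    · have h4 := h1 hd (lr_even_comm hCAR hd (hΦeven Z r hr) hB)
      calc D Z r ≤ _ := h4
        _ ≤ 2 * ‖Φ Z r‖ * ∑ z ∈ Λ, if z ∈ Z then (∫ x in s..r, E z x) else 0 := by
          gcongr
        _ ≤ _ := by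
          gcongr
          apply le_add_of_nonneg_left
          apply mul_nonneg (norm_nonneg _)
          apply Finset.sum_nonneg
          intro y _
          split_ifs <;> norm_num
    · obtain ⟨y, hy1, hy2⟩ := Finset.not_disjoint_iff.1 hd
      have h5 : (1 : ℝ) ≤ ∑ y ∈ Y, if y ∈ Z then 1 else 0 := by
        calc (1 : ℝ) = if y ∈ Z then 1 else 0 := by rw [if_pos hy1]
          _ ≤ _ := Finset.single_le_sum (f := fun y => if y ∈ Z then (1 : ℝ) else 0)
            (fun y _ => by split_ifs <;> norm_num) hy2
      calc D Z r ≤ _ := h2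
        _ ≤ 2 * ‖Φ Z r‖ * ‖B‖ +
            2 * ‖Φ Z r‖ * ∑ z ∈ Λ, if z ∈ Z then (∫ x in s..r, E z x) else 0 := by
          gcongr
        _ = 2 * ‖Φ Z r‖ * (‖B‖ * 1 + ∑ z ∈ Λ, if z ∈ Z then (∫ x in s..r, E z x) else 0) := by
          ring
        _ ≤ _ := by gcongr
  have hsys : ∀ w ∈ Λ, ∀ r ∈ Set.Icc s t,
      E w r ≤ 2 * n r * (‖B‖ * gY w + ∑ z ∈ Λ, G w z * ∫ x in s..r, E z x) := by
    intro w hw r hr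
    have he0 : ∀ z, 0 ≤ ∫ x in s..r, E z x := fun z =>
      intervalIntegral.integral_nonneg hr.1 (fun u _ => hE0 z u)
    calc E w r ≤ ∑ Z ∈ Λ.powerset, if w ∈ Z then 2 * ‖Φ Z r‖ *
          (‖B‖ * (∑ y ∈ Y, if y ∈ Z then 1 else 0) +
            ∑ z ∈ Λ, if z ∈ Z then (∫ x in s..r, E z x) else 0) else 0 := by
          apply Finset.sum_le_sum
          intro Z hZ
          split_ifs
          · exact hDb Z hZ r hr
          · exact le_rfl
      _ = 2 * (‖B‖ * ∑ y ∈ Y, σ w y r + ∑ z ∈ Λ, σ w z r * ∫ x in s..r, E z x) := by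
          simp only [hσ]
          rw [Finset.sum_comm]
          simp only [Finset.sum_mul]
          rw [Finset.sum_comm (s := Λ), Finset.mul_sum, ← Finset.sum_add_distrib, Finset.mul_sum]
          apply Finset.sum_congr rfl
          intro Z _
          by_cases hwZ : w ∈ Z
          · simp only [hwZ, if_true, true_and, mul_add, Finset.mul_sum]
            congr 1
            · apply Finset.sum_congr rfl
              intro y _
              split_ifs <;> ring
            · apply Finset.sum_congr rfl
              intro y _
              split_ifs <;> ring
          · simp [hwZ]
      _ ≤ 2 * (‖B‖ * ∑ y ∈ Y, n r * G w y + ∑ z ∈ Λ, n r * G w z * ∫ x in s..r, E z x) := by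
          gcongr with y hy z hz
          · exact hσn w hw y (hYΛ hy) r
          · exact he0 z
          · exact hσn w hw z hz r
      _ = _ := by
          simp only [hgY, mul_assoc, ← Finset.mul_sum]
          ring
  have hconv : ∀ w ∈ Λ, ∑ z ∈ Λ, G w z * gY z ≤ gY w := by
    intro w _
    simp only [hgY, Finset.mul_sum]
    rw [Finset.sum_comm]
    apply Finset.sum_le_sum
    intro y _
    obtain ⟨h1, h2⟩ := hGconv w y
    exact (h1.sum_le_tsum _ (fun z _ => (mul_pos (hGpos _ _) (hGpos _ _)).le)).trans h2
  have hfin := lr_system hst Λ G (fun x y => (hGpos x y).le) n hnc (fun r _ => hn0 r) E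
    (fun w _ => hEc w) gY ‖B‖ (norm_nonneg _) hsys hconv
  have hXb := (hstep t htm X Y A₀ B hA hB).1 hXY hcomm
  have hbdry : (∫ u in s..t, ∑ Z ∈ Λ.powerset with ¬ Z ⊆ X ∧ ¬ Disjoint Z X, D Z u) ≤
      ∑ x ∈ T, ∫ u in s..t, E x u := by
    apply hint _ _ (Finset.filter_subset _ _) t htm
    intro r hr Z hZ
    simp only [Finset.mem_filter] at hZ
    by_cases h0 : Φ Z r = 0
    · left; simp [hD, h0]
    · right
      obtain ⟨x, hx1, hx2⟩ := Finset.not_disjoint_iff.1 hZ.2.2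
      exact ⟨x, hT Z r hr x hx2 hx1 hZ.2.1 h0, hx1⟩
  have hexp : (∫ r in s..t, n r) ≤ ∫ r in s..t, nΦ r := by
    apply intervalIntegral.integral_mono_on hst _ hnΦint hnle
    apply ContinuousOn.intervalIntegrable
    rwa [Set.uIcc_of_le hst]
  have hgY0 : ∀ x, 0 ≤ gY x := fun x => Finset.sum_nonneg (fun y _ => (hGpos x y).le)
  calc _ ≤ _ := hXb
    _ ≤ 2 * ‖A₀‖ * ∑ x ∈ T, ∫ u in s..t, E x u := by gcongr
    _ ≤ 2 * ‖A₀‖ * ∑ x ∈ T, ‖B‖ * (Real.exp (2 * ∫ r in s..t, nΦ r) - 1) * gY x := by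
      gcongr with x hx
      refine (hfin x (hXΛ (hTX hx)) t htm).trans ?_
      have := hgY0 x
      gcongr
    _ = _ := by rw [← Finset.mul_sum]; ring

end helper_main

open MeasureTheory in
/-- Lieb-Robinson bound for lattice fermions, commutator version. -/
theorem lieb_robinson_fermions_commutator
    {Γ A : Type*} [Countable Γ]
    [NormedRing A] [StarRing A] [CStarRing A] [NormedAlgebra ℂ A] [CompleteSpace A]
    (a : Γ → A) (hCAR : IsCAR a)
    -- the interval `I`
    (I : Set ℝ) (hI : I.OrdConnected)
    -- the even, time-dependent interaction `Φ ∈ B_G⁺(I)`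
    (Φ : Finset Γ → ℝ → A)
    (hΦsa : ∀ Z : Finset Γ, ∀ t ∈ I, star (Φ Z t) = Φ Z t)
    (hΦeven : ∀ Z : Finset Γ, ∀ t ∈ I, Φ Z t ∈ carSpanEven a Z)
    (hΦcont : ∀ Z : Finset Γ, ContinuousOn (Φ Z) I)
    -- the decay function `G`
    (G : Γ → Γ → ℝ)
    (hGpos : ∀ x y, 0 < G x y)
    (hGsymm : ∀ x y, G x y = G y x)
    (hGsum : ∀ x, Summable (G x))
    (hGconv : ∀ x y, Summable (fun z => G x z * G z y) ∧ ∑' z, G x z * G z y ≤ G x y)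
    (hGbdd : ∃ M : ℝ, ∀ x, ∑' z, G x z ≤ M)
    -- the (time-dependent) interaction norm `‖Φ‖_G`, locally integrable on `I`
    (nΦ : ℝ → ℝ)
    (hnΦ : ∀ t ∈ I, 0 ≤ nΦ t)
    (hnΦint : ∀ s ∈ I, ∀ t ∈ I, IntervalIntegrable nΦ volume s t)
    (hΦG : ∀ x y : Γ, ∀ t ∈ I,
      Summable (fun Z : {Z : Finset Γ // x ∈ Z ∧ y ∈ Z} => ‖Φ Z.1 t‖) ∧
      ∑' Z : {Z : Finset Γ // x ∈ Z ∧ y ∈ Z}, ‖Φ Z.1 t‖ ≤ nΦ t * G x y)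
    -- the finite volume `Λ` and the unitary propagator `U_Λ(t,s)` generated by
    -- `H_Λ(t) = ∑_{Z ⊆ Λ} Φ(Z,t)`
    (Λ : Finset Γ)
    (U : ℝ → ℝ → A)
    (hUunitary : ∀ s ∈ I, ∀ t ∈ I, U t s ∈ unitary A)
    (hUmem : ∀ s ∈ I, ∀ t ∈ I, U t s ∈ carSpan a Λ)
    (hUinit : ∀ s ∈ I, U s s = 1)
    (hUode : ∀ s ∈ I, ∀ t ∈ I,
      HasDerivWithinAt (fun r => U r s)
        ((-Complex.I) • ((∑ Z ∈ Λ.powerset, Φ Z t) * U t s)) I t)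
    -- disjoint supports `X, Y ⊆ Λ` and observables `A₀ ∈ 𝔄_X`, `B₀ ∈ 𝔄_Y`
    (X Y : Finset Γ) (hXΛ : X ⊆ Λ) (hYΛ : Y ⊆ Λ) (hXY : Disjoint X Y)
    (A₀ B₀ : A) (hA : A₀ ∈ carSpan a X) (hB : B₀ ∈ carSpan a Y)
    (hcomm : A₀ * B₀ - B₀ * A₀ = 0)
    (s t : ℝ) (hs : s ∈ I) (ht : t ∈ I) (hst : s ≤ t) :
    ‖(star (U t s) * A₀ * U t s) * B₀ - B₀ * (star (U t s) * A₀ * U t s)‖ ≤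
      2 * ‖A₀‖ * ‖B₀‖ * (Real.exp (2 * ∫ r in s..t, nΦ r) - 1) *
        ∑ x ∈ X.filter (fun x => ∃ Z : Finset Γ, ∃ t' ∈ I,
            x ∈ Z ∧ (Z ∩ X).Nonempty ∧ (Z \ X).Nonempty ∧ Φ Z t' ≠ 0),
          ∑ y ∈ Y, G x y := by
  have hIcc : Set.Icc s t ⊆ I := hI.out hs ht
  rcases X.eq_empty_or_nonempty with hX | hX
  · subst hX
    have hc := lr_empty hA
    have e : star (U t s) * A₀ * U t s = A₀ := by
      rw [hc (star (U t s)), mul_assoc, (Unitary.mem_iff.1 (hUunitary s hs t ht)).1, mul_one]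
    rw [e, hcomm]
    simp
  · obtain ⟨x0, hx0⟩ := hX
    have hSM : StarModule ℂ A := lr_starModule hCAR x0
    refine lr_main hCAR hst Φ (fun Z r hr => hΦsa Z r (hIcc hr))
      (fun Z r hr => hΦeven Z r (hIcc hr)) (fun Z => (hΦcont Z).mono hIcc) Λ ⟨x0, hXΛ hx0⟩
      (fun r => U r s) (hUinit s hs)
      (fun r hr => (Unitary.mem_iff.1 (hUunitary s hs r (hIcc hr))).1)
      (fun r hr => (Unitary.mem_iff.1 (hUunitary s hs r (hIcc hr))).2)
      (fun r hr => (hUode s hs r (hIcc hr)).mono hIcc) G hGpos hGconv nΦ (hnΦint s hs t ht)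
      (fun x y r hr => hΦG x y r (hIcc hr)) X Y hXΛ hYΛ hXY A₀ B₀ hA hB (sub_eq_zero.1 hcomm)
      _ (Finset.filter_subset _ _) ?_
    intro Z r hr x hx hxZ hZX h0
    rw [Finset.mem_filter]
    refine ⟨hx, Z, r, hIcc hr, hxZ, ⟨x, Finset.mem_inter.2 ⟨hxZ, hx⟩⟩, ?_, h0⟩
    exact Finset.sdiff_nonempty.2 hZX
end

section
/- Lieb-Robinson bound for lattice fermions, anticommutator version: Let Φ ∈ B_G⁺(I) be an even time-dependent interaction, Λ ⊆ Γ finite, and let τ_{t,s}^Λ be the finite-volume Heisenberg dynamics generated by H_Λ(t). Let X, Y ⊆ Λ with X ∩ Y = ∅. If A ∈ 𝔄_X, B ∈ 𝔄_Y and {A,B} = 0, then for all s, t ∈ I with s ≤ t one has ‖{τ_{t,s}^Λ(A), B}‖ ≤ 2‖A‖‖B‖ (exp(2∫_s^t ‖Φ‖_G(r) dr) − 1) ∑_{x ∈ ∂_Φ X} ∑_{y ∈ Y} G(x,y). -/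
open scoped Classical

section LRFAux
open MeasureTheory

theorem lrf_ac_exp {N : ℝ → ℝ} {a b : ℝ} (hN : AbsolutelyContinuousOnInterval N a b) :
    AbsolutelyContinuousOnInterval (fun r => Real.exp (2 * N r)) a b := by
  obtain ⟨C, hC⟩ := hN.exists_bound
  have key : ∀ x ∈ Set.uIcc a b, ∀ y ∈ Set.uIcc a b,
      dist (Real.exp (2 * N x)) (Real.exp (2 * N y)) ≤ (Real.exp (2 * C) * 2) * dist (N x) (N y) := by
    have hlip : LipschitzOnWith (Real.exp (2 * C) * 2).toNNReal (fun u : ℝ => Real.exp (2 * u))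
        (Set.Icc (-C) C) := by
      apply Convex.lipschitzOnWith_of_nnnorm_hasDerivWithin_le (convex_Icc _ _)
        (f' := fun u => Real.exp (2 * u) * 2)
      · intro x _
        have := ((hasDerivAt_id x).const_mul 2).exp
        simpa using this.hasDerivWithinAt
      · intro x hx
        rw [← NNReal.coe_le_coe, coe_nnnorm, Real.coe_toNNReal _ (by positivity),
          Real.norm_of_nonneg (by positivity)]
        have := hx.2
        gcongr
    intro x hx y hy
    have h1 := hlip.dist_le_mul (N x) (abs_le.mp (hC x hx)) (N y) (abs_le.mp (hC y hy))
    rwa [Real.coe_toNNReal _ (by positivity)] at h1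
  unfold AbsolutelyContinuousOnInterval at hN ⊢
  have h0 := hN.const_mul (Real.exp (2 * C) * 2)
  rw [mul_zero] at h0
  refine squeeze_zero' (Filter.Eventually.of_forall fun E => Finset.sum_nonneg fun _ _ => dist_nonneg)
    ?_ h0
  have hE : ∀ᶠ E in (AbsolutelyContinuousOnInterval.totalLengthFilter ⊓
      Filter.principal (AbsolutelyContinuousOnInterval.disjWithin a b)),
      E ∈ AbsolutelyContinuousOnInterval.disjWithin a b :=
    Filter.mem_inf_of_right (Filter.mem_principal_self _)
  filter_upwards [hE] with E hE
  rw [Finset.mul_sum]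
  refine Finset.sum_le_sum fun i hi => ?_
  have := hE.1 i hi
  exact key _ this.1 _ this.2

theorem lrf_exp_integral {n : ℝ → ℝ} {s t : ℝ}
    (hn : IntervalIntegrable n volume s t) :
    ∫ r in s..t, n r * Real.exp (2 * ∫ u in s..r, n u) =
      (Real.exp (2 * ∫ u in s..t, n u) - 1) / 2 := by
  have hac := lrf_ac_exp (hn.absolutelyContinuousOnInterval_intervalIntegral
    (c := s) (by simp))
  have h := hac.integral_deriv_eq_sub
  have h2 : ∫ r in s..t, deriv (fun r => Real.exp (2 * ∫ u in s..r, n u)) r =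
      ∫ r in s..t, 2 * (n r * Real.exp (2 * ∫ u in s..r, n u)) := by
    apply intervalIntegral.integral_congr_ae
    filter_upwards [hn.ae_hasDerivAt_integral] with x hx hxm
    have := hx (Set.uIoc_subset_uIcc hxm) s (by simp)
    rw [((this.const_mul 2).exp).deriv]
    ring
  rw [h2, intervalIntegral.integral_const_mul] at h
  simp at h
  linarith

theorem lrf_exp_cont {n : ℝ → ℝ} {s t : ℝ} 
    (hn : IntervalIntegrable n volume s t) :
    ContinuousOn (fun r => Real.exp (2 * ∫ u in s..r, n u)) (Set.uIcc s t) :=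
  (lrf_ac_exp (hn.absolutelyContinuousOnInterval_intervalIntegral
    (c := s) (by simp))).continuousOn

theorem lrf_starI {A : Type*}
    [NormedRing A] [StarRing A] [CStarRing A] [NormedAlgebra ℂ A]
    (b : A) (h2 : b * b = 0) (h1 : b * star b + star b * b = 1) :
    star (Complex.I • (1 : A)) = -(Complex.I • (1 : A)) := by
  set i : A := Complex.I • (1 : A) with hi
  have hic : ∀ x, i * x = x * i := by intro x; simp [hi]
  have hjc : ∀ x, star i * x = x * star i := by
    intro x
    have := congrArg star (hic (star x))
    simpa using this.symm
  have hii : i * i = -1 := by simp [hi, smul_smul]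
  have hjj : star i * star i = -1 := by rw [← star_mul, hii]; simp
  have hs2 : star b * star b = 0 := by rw [← star_mul, h2]; simp
  have hp : star (i * star i) = i * star i := by simp
  set k : A := i * star i with hk
  have hkc : ∀ x, k * x = x * k := by
    intro x; rw [hk, mul_assoc, hjc, ← mul_assoc, hic, mul_assoc]
  have hkk : k * k = 1 := by
    rw [hk]; calc i * star i * (i * star i) = i * (star i * i) * star i := by noncomm_ring
      _ = i * (i * star i) * star i := by rw [hjc]
      _ = (i * i) * (star i * star i) := by noncomm_ring
      _ = 1 := by rw [hii, hjj]; simp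
  have hik : i * k = - star i := by rw [hk, ← mul_assoc, hii]; simp
  -- r = 1 - k is twice the bad projection
  set r : A := 1 - k with hr
  have hrs : star r = r := by simp [hr, hp]
  have hrc : ∀ x, r * x = x * r := by intro x; simp [hr, sub_mul, mul_sub, hkc]
  have hri : r * star i = r * i := by
    have : r * i = i + star i := by rw [hrc, hr, mul_sub, hik]; simp
    have h' : r * star i = i + star i := by
      rw [hr, sub_mul, hk, mul_assoc, hjj]; simp [add_comm]
    rw [this, h']
  set x : A := r * (b * star b + i * star b) with hx
  have hxs : star x = r * (b * star b + i * b) := by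
    rw [hx, star_mul, hrs, ← hrc, star_add, star_mul, star_mul, star_star, mul_add, mul_add]
    congr 1
    rw [← hjc, ← mul_assoc, hri, mul_assoc]
  have hbsb : b * star b * b = b := by
    have := congrArg (fun z => b * z) h1
    simp only [mul_add, mul_one] at this
    rw [← mul_assoc, h2, zero_mul, zero_add, ← mul_assoc] at this
    exact this
  have hxx : star x * x = 0 := by
    rw [hxs, hx]
    have e1 : r * (b * star b + i * b) * (r * (b * star b + i * star b)) =
       r * r * ((b * star b + i * b) * (b * star b + i * star b)) := by
      calc _ = r * ((b * star b + i * b) * r) * (b * star b + i * star b) := by noncomm_ring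
        _ = _ := by rw [← hrc]; noncomm_ring
    have e2 : (b * star b + i * b) * (b * star b + i * star b) = 0 := by
      have t1 : b * star b * (i * star b) = 0 := by
        rw [hic, mul_assoc, ← mul_assoc (star b), hs2]; simp
      have t2 : i * b * (b * star b) = 0 := by
        rw [mul_assoc, ← mul_assoc b b, h2]; simp
      have t3 : i * b * (i * star b) = - (b * star b) := by
        rw [hic, mul_assoc, ← mul_assoc i i, hii]; simp
      rw [mul_add, add_mul, add_mul, t1, t2, t3, ← mul_assoc, hbsb]; simp
    rw [e1, e2, mul_zero]
  have hx0 : x = 0 := CStarRing.star_mul_self_eq_zero_iff x |>.1 hxx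
  have h3 : r * (b * star b) = 0 := by
    have : (b * star b) * x = r * (b * star b) := by
      rw [hx, ← mul_assoc, ← hrc, mul_assoc, mul_add, ← mul_assoc, hbsb, hic, ← mul_assoc,
        mul_assoc b, hs2]
      simp
    rw [← this, hx0, mul_zero]
  have h4 : r * b = 0 := by rw [← hbsb, ← mul_assoc, h3, zero_mul]
  have h5 : r = 0 := by
    have := congrArg (fun z => r * z) h1
    simp only [mul_add, mul_one] at this
    rw [h3, hrc (star b * b), mul_assoc, ← hrc, h4] at this
    simpa using this.symm
  have h6 : k = 1 := by rw [hr] at h5; exact (sub_eq_zero.mp h5).symm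
  rw [h6, mul_one] at hik
  rw [eq_neg_iff_add_eq_zero, ← eq_neg_iff_add_eq_zero.mp hik, add_comm]

theorem lrf_starModule {A : Type*}
    [NormedRing A] [StarRing A] [CStarRing A] [NormedAlgebra ℂ A]
    (h : star (Complex.I • (1 : A)) = -(Complex.I • (1 : A))) : StarModule ℂ A := by
  have hreal : ∀ (c : ℝ) (x : A), star (c • x) = c • star x := fun c x =>
    map_real_smul (starAddEquiv : A ≃+ A) continuous_star c x
  have hI : ∀ x : A, star (Complex.I • x) = -(Complex.I • star x) := by
    intro x
    have : Complex.I • x = (Complex.I • (1 : A)) * x := by simp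
    rw [this, star_mul, h]; simp
  constructor
  intro z x
  conv_lhs => rw [← Complex.re_add_im z]
  rw [add_smul, star_add, mul_comm, mul_smul, hI, Complex.coe_smul, Complex.coe_smul, hreal, hreal]
  have : star z = (z.re : ℂ) - Complex.I * z.im := by
    apply Complex.ext <;> simp
  rw [this, sub_smul, mul_smul, Complex.coe_smul, Complex.coe_smul, sub_eq_add_neg]

theorem lrf_deriv_ici {E : Type*} [NormedAddCommGroup E] [NormedSpace ℝ E] {f : ℝ → E} {f' : E}
    {s t x : ℝ} (h : HasDerivWithinAt f f' (Set.Icc s t) x) (hx : x ∈ Set.Ico s t) :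
    HasDerivWithinAt f f' (Set.Ici x) x :=
  h.mono_of_mem_nhdsWithin (Icc_mem_nhdsGE_of_mem hx)

theorem lrf_const {E : Type*} [NormedAddCommGroup E] [NormedSpace ℝ E] {f : ℝ → E}
    {s t : ℝ} (h : ∀ r ∈ Set.Icc s t, HasDerivWithinAt f 0 (Set.Icc s t) r) :
    ∀ r ∈ Set.Icc s t, f r = f s :=
  constant_of_has_deriv_right_zero (fun r hr => (h r hr).continuousWithinAt)
    (fun r hr => lrf_deriv_ici (h r ⟨hr.1, hr.2.le⟩) hr)

/-- Retraction-like truncation, bounded, Lipschitz and the identity on the unit sphere. -/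
noncomputable def lrfTrunc {E : Type*} [NormedAddCommGroup E] [NormedSpace ℝ E] (x : E) : E :=
  (2 / (1 + ‖x‖)) • x

theorem lrf_trunc_norm {E : Type*} [NormedAddCommGroup E] [NormedSpace ℝ E] (x : E) :
    ‖lrfTrunc x‖ ≤ 2 := by
  have := norm_nonneg x
  rw [lrfTrunc, norm_smul, Real.norm_of_nonneg (by positivity), div_mul_eq_mul_div,
    div_le_iff₀ (by positivity)]
  linarith

theorem lrf_trunc_lip {E : Type*} [NormedAddCommGroup E] [NormedSpace ℝ E] (x y : E) :
    ‖lrfTrunc x - lrfTrunc y‖ ≤ 4 * ‖x - y‖ := by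
  have hx := norm_nonneg x
  have hy := norm_nonneg y
  have e : lrfTrunc x - lrfTrunc y = (2 / (1 + ‖x‖)) • (x - y) +
      (2 / (1 + ‖x‖) - 2 / (1 + ‖y‖)) • y := by
    simp only [lrfTrunc, smul_sub, sub_smul]; abel
  have h1 : ‖(2 / (1 + ‖x‖)) • (x - y)‖ ≤ 2 * ‖x - y‖ := by
    rw [norm_smul, Real.norm_of_nonneg (by positivity)]
    gcongr
    rw [div_le_iff₀ (by positivity)]; linarith
  have h2 : ‖(2 / (1 + ‖x‖) - 2 / (1 + ‖y‖)) • y‖ ≤ 2 * ‖x - y‖ := by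
    have e2 : 2 / (1 + ‖x‖) - 2 / (1 + ‖y‖) = (2 / ((1 + ‖x‖) * (1 + ‖y‖))) * (‖y‖ - ‖x‖) := by
      field_simp; ring
    have h3 : |‖y‖ - ‖x‖| ≤ ‖x - y‖ := by rw [norm_sub_rev]; exact abs_norm_sub_norm_le y x
    rw [norm_smul, e2, norm_mul, Real.norm_of_nonneg (by positivity), Real.norm_eq_abs]
    have h4 : 2 / ((1 + ‖x‖) * (1 + ‖y‖)) * ‖y‖ ≤ 2 := by
      rw [div_mul_eq_mul_div, div_le_iff₀ (by positivity)]
      nlinarith [mul_nonneg hx hy]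
    calc _ = (2 / ((1 + ‖x‖) * (1 + ‖y‖)) * ‖y‖) * |‖y‖ - ‖x‖| := by ring
      _ ≤ 2 * ‖x - y‖ := by gcongr
  rw [e]
  refine (norm_add_le _ _).trans ?_
  linarith

section
set_option linter.unusedSectionVars false
variable {A : Type*}
    [NormedRing A] [StarRing A] [CStarRing A] [NormedAlgebra ℂ A] [CompleteSpace A]
    [StarModule ℂ A]

theorem lrf_exists_unitary {H : ℝ → A} {s t : ℝ} (hst : s ≤ t)
    (hc : ContinuousOn H (Set.Icc s t)) (hsa : ∀ r ∈ Set.Icc s t, star (H r) = H r) :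
    ∃ V : ℝ → A, V s = 1 ∧ (∀ r ∈ Set.Icc s t, V r ∈ unitary A) ∧
      ∀ r ∈ Set.Icc s t, HasDerivWithinAt V ((-Complex.I) • (H r * V r)) (Set.Icc s t) r := by
  rcases subsingleton_or_nontrivial A with hA | hA
  · refine ⟨fun _ => 1, rfl, fun _ _ => one_mem _, fun r hr => ?_⟩
    rw [Subsingleton.elim ((-Complex.I) • (H r * 1)) 0]
    exact hasDerivWithinAt_const _ _ _
  obtain ⟨C, hC⟩ := isCompact_Icc.exists_bound_of_continuousOn hc
  have hC0 : 0 ≤ C := (norm_nonneg _).trans (hC s ⟨le_rfl, hst⟩)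
  have hPL : IsPicardLindelof (fun r x => (-Complex.I) • (H r * lrfTrunc x))
      (⟨s, le_rfl, hst⟩ : Set.Icc s t) (1 : A) (C * 2 * (t - s)).toNNReal 0
      (C * 2).toNNReal (C * 4).toNNReal := by
    constructor
    · intro r hr
      refine LipschitzWith.lipschitzOnWith (LipschitzWith.of_dist_le_mul fun x y => ?_)
      rw [Real.coe_toNNReal _ (by positivity), dist_eq_norm, dist_eq_norm, ← smul_sub, ← mul_sub,
        norm_smul, norm_neg, Complex.norm_I, one_mul, mul_assoc]
      refine (norm_mul_le _ _).trans ?_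
      gcongr
      · exact hC r hr
      · exact lrf_trunc_lip x y
    · intro x _
      exact (hc.mul continuousOn_const).const_smul (-Complex.I)
    · intro r hr x _
      rw [Real.coe_toNNReal _ (by positivity), norm_smul, norm_neg, Complex.norm_I, one_mul]
      refine (norm_mul_le _ _).trans ?_
      gcongr
      · exact hC r hr
      · exact lrf_trunc_norm x
    · have : 0 ≤ t - s := by linarith
      rw [Real.coe_toNNReal _ (by positivity), Real.coe_toNNReal _ (by positivity)]
      simp [this]
  obtain ⟨V, hV0, hV⟩ := hPL.exists_eq_forall_mem_Icc_hasDerivWithinAt₀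
  simp only at hV0
  have hVc : ContinuousOn V (Set.Icc s t) := fun r hr => (hV r hr).continuousWithinAt
  have h1 : ∀ r ∈ Set.Icc s t, star (V r) * V r = 1 := by
    have hd : ∀ r ∈ Set.Icc s t, HasDerivWithinAt (fun r => star (V r) * V r) 0 (Set.Icc s t) r := by
      intro r hr
      have := (hV r hr).star.mul (hV r hr)
      refine HasDerivWithinAt.congr_deriv this (Eq.symm ?_)
      simp only [lrfTrunc, star_smul, star_mul, hsa r hr]
      simp [mul_assoc]
    intro r hr
    have := lrf_const hd r hr
    simpa [hV0] using this
  have hn : ∀ r ∈ Set.Icc s t, lrfTrunc (V r) = V r := by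
    intro r hr
    have h2 : ‖V r‖ * ‖V r‖ = 1 := by rw [← CStarRing.norm_star_mul_self, h1 r hr, CStarRing.norm_one]
    have h3 : ‖V r‖ = 1 := by nlinarith [norm_nonneg (V r)]
    rw [lrfTrunc, h3]; norm_num
  have hV' : ∀ r ∈ Set.Icc s t,
      HasDerivWithinAt V ((-Complex.I) • (H r * V r)) (Set.Icc s t) r := by
    intro r hr
    have := hV r hr
    rwa [hn r hr] at this
  have h2 : ∀ r ∈ Set.Icc s t, V r * star (V r) - 1 = 0 := by
    have hd : ∀ r ∈ Set.Icc s t, HasDerivWithinAt (fun r => V r * star (V r) - 1)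
        ((-Complex.I) • (H r * (V r * star (V r) - 1) - (V r * star (V r) - 1) * H r))
        (Set.Icc s t) r := by
      intro r hr
      have := ((hV' r hr).mul (hV' r hr).star).sub_const 1
      refine HasDerivWithinAt.congr_deriv this (Eq.symm ?_)
      simp only [star_smul, star_mul, hsa r hr]
      simp [mul_assoc, mul_sub, sub_mul, smul_sub]
    refine eq_zero_of_abs_deriv_le_mul_abs_self_of_eq_zero_right (K := 2 * C)
      (fun r hr => (hd r hr).continuousWithinAt)
      (fun r hr => lrf_deriv_ici (hd r ⟨hr.1, hr.2.le⟩) hr) (by simp [hV0]) ?_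
    intro r hr
    rw [norm_smul, norm_neg, Complex.norm_I, one_mul]
    refine (norm_sub_le _ _).trans ?_
    have e1 := norm_mul_le (H r) (V r * star (V r) - 1)
    have e2 := norm_mul_le (V r * star (V r) - 1) (H r)
    have e3 := hC r ⟨hr.1, hr.2.le⟩
    have e4 := norm_nonneg (V r * star (V r) - 1)
    nlinarith
  exact ⟨V, hV0, fun r hr => Unitary.mem_iff.mpr ⟨h1 r hr, sub_eq_zero.mp (h2 r hr)⟩, hV'⟩

theorem lrf_commute {H V : ℝ → A} {s t : ℝ} {C : A}
    (hsa : ∀ r ∈ Set.Icc s t, star (H r) = H r)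
    (hV0 : V s = 1) (hVu : ∀ r ∈ Set.Icc s t, V r ∈ unitary A)
    (hV : ∀ r ∈ Set.Icc s t, HasDerivWithinAt V ((-Complex.I) • (H r * V r)) (Set.Icc s t) r)
    (hC : ∀ r ∈ Set.Icc s t, Commute (H r) C) :
    ∀ r ∈ Set.Icc s t, Commute (V r) C := by
  have hd : ∀ r ∈ Set.Icc s t, HasDerivWithinAt (fun r => star (V r) * C * V r) 0
      (Set.Icc s t) r := by
    intro r hr
    have := ((hV r hr).star.mul_const C).mul (hV r hr)
    refine HasDerivWithinAt.congr_deriv this (Eq.symm ?_)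
    simp only [star_smul, star_mul, hsa r hr]
    have h1 := (hC r hr).eq
    simp only [mul_assoc, smul_mul_assoc, mul_smul_comm]
    rw [← mul_assoc (H r) C, h1]
    simp [mul_assoc]
  intro r hr
  have h1 := lrf_const hd r hr
  simp only [hV0, star_one, one_mul, mul_one] at h1
  have h2 := (Unitary.mem_iff.mp (hVu r hr)).2
  have := congrArg (fun z => V r * z) h1
  rw [← mul_assoc, ← mul_assoc, h2, one_mul] at this
  exact this.symm

theorem lrf_norm_conj {W Q : A} (hW : W ∈ unitary A) : ‖star W * Q * W‖ = ‖Q‖ := by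
  rw [CStarRing.norm_mul_mem_unitary _ hW, CStarRing.norm_mem_unitary_mul _ (Unitary.star_mem hW)]

theorem lrf_step {U Hi Ho Hd : ℝ → A} {s t : ℝ} (hst : s ≤ t) {A₀ B : A} {ε : ℂ} (hε : ‖ε‖ = 1)
    (hU0 : U s = 1) (hUu : ∀ r ∈ Set.Icc s t, U r ∈ unitary A)
    (hU : ∀ r ∈ Set.Icc s t,
      HasDerivWithinAt U ((-Complex.I) • ((Hi r + Ho r + Hd r) * U r)) (Set.Icc s t) r)
    (hic : ContinuousOn Hi (Set.Icc s t)) (hoc : ContinuousOn Ho (Set.Icc s t))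
    (hdc : ContinuousOn Hd (Set.Icc s t))
    (his : ∀ r ∈ Set.Icc s t, star (Hi r) = Hi r) (hos : ∀ r ∈ Set.Icc s t, star (Ho r) = Ho r)
    (hds : ∀ r ∈ Set.Icc s t, star (Hd r) = Hd r)
    (hio : ∀ r ∈ Set.Icc s t, ∀ r' ∈ Set.Icc s t, Commute (Hi r) (Ho r'))
    (hAo : ∀ r ∈ Set.Icc s t, Commute (Ho r) A₀)
    (hiB : ∀ r ∈ Set.Icc s t, Commute (Hi r) B)
    (hAB : A₀ * B + ε • (B * A₀) = 0)
    {b : ℝ → ℝ} (hb : IntervalIntegrable b volume s t)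
    (hbound : ∀ r ∈ Set.Icc s t,
      ‖(star (U r) * Hd r * U r) * B - B * (star (U r) * Hd r * U r)‖ ≤ b r) :
    ‖(star (U t) * A₀ * U t) * B + ε • (B * (star (U t) * A₀ * U t))‖ ≤
      2 * ‖A₀‖ * ∫ r in s..t, b r := by
  obtain ⟨Vi, hVi0, hViu, hVi⟩ := lrf_exists_unitary hst hic his
  obtain ⟨Vo, hVo0, hVou, hVo⟩ := lrf_exists_unitary hst hoc hos
  have htm : t ∈ Set.Icc s t := ⟨hst, le_rfl⟩
  have hViHo : ∀ r ∈ Set.Icc s t, ∀ r' ∈ Set.Icc s t, Commute (Vi r) (Ho r') := fun r hr r' hr' =>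
    lrf_commute his hVi0 hViu hVi (fun q hq => hio q hq r' hr') r hr
  have hViB : ∀ r ∈ Set.Icc s t, Commute (Vi r) B := lrf_commute his hVi0 hViu hVi hiB
  have hVoA : ∀ r ∈ Set.Icc s t, Commute (Vo r) A₀ := lrf_commute hos hVo0 hVou hVo hAo
  have hVoVi : ∀ r ∈ Set.Icc s t, ∀ r' ∈ Set.Icc s t, Commute (Vo r) (Vi r') := fun r hr r' hr' =>
    lrf_commute hos hVo0 hVou hVo (fun q hq => (hViHo r' hr' q hq).symm) r hr
  set V : ℝ → A := fun r => Vi r * Vo r with hVdef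
  have hVu : ∀ r ∈ Set.Icc s t, V r ∈ unitary A := fun r hr => mul_mem (hViu r hr) (hVou r hr)
  have hV : ∀ r ∈ Set.Icc s t,
      HasDerivWithinAt V ((-Complex.I) • ((Hi r + Ho r) * V r)) (Set.Icc s t) r := by
    intro r hr
    have := (hVi r hr).mul (hVo r hr)
    refine HasDerivWithinAt.congr_deriv this (Eq.symm ?_)
    have h := (hViHo r hr r hr).eq
    simp only [hVdef, mul_smul_comm, smul_mul_assoc, add_mul, smul_add, ← mul_assoc, h]
  set W : ℝ → A := fun r => star (U r) * V r with hWdef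
  have hWu : ∀ r ∈ Set.Icc s t, W r ∈ unitary A := fun r hr =>
    mul_mem (Unitary.star_mem (hUu r hr)) (hVu r hr)
  have hW : ∀ r ∈ Set.Icc s t,
      HasDerivWithinAt W (Complex.I • ((star (U r) * Hd r * U r) * W r)) (Set.Icc s t) r := by
    intro r hr
    have := (hU r hr).star.mul (hV r hr)
    refine HasDerivWithinAt.congr_deriv this (Eq.symm ?_)
    have hUU := (Unitary.mem_iff.mp (hUu r hr)).2
    simp only [hWdef, star_smul, star_mul, star_add, his r hr, hos r hr, hds r hr]
    rw [mul_assoc (star (U r) * Hd r), ← mul_assoc (U r) (star (U r)), hUU, one_mul]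
    simp [mul_add, add_mul, mul_assoc]
    abel
  have hWc : ContinuousOn W (Set.Icc s t) := fun r hr => (hW r hr).continuousWithinAt
  have hUc : ContinuousOn U (Set.Icc s t) := fun r hr => (hU r hr).continuousWithinAt
  set K : ℝ → A := fun r => (star (U r) * Hd r * U r) * B - B * (star (U r) * Hd r * U r) with hK
  have hKc : ContinuousOn K (Set.Icc s t) := by
    have : ContinuousOn (fun r => star (U r) * Hd r * U r) (Set.Icc s t) :=
      (hUc.star.mul hdc).mul hUc
    exact (this.mul continuousOn_const).sub (continuousOn_const.mul this)
  set Q : ℝ → A := fun r => star (W r) * B * W r with hQdef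
  set Q' : ℝ → A := fun r => (-Complex.I) • (star (W r) * K r * W r) with hQ'def
  have hQ : ∀ r ∈ Set.Icc s t, HasDerivWithinAt Q (Q' r) (Set.Icc s t) r := by
    intro r hr
    have := ((hW r hr).star.mul_const B).mul (hW r hr)
    refine HasDerivWithinAt.congr_deriv this (Eq.symm ?_)
    simp only [hQ'def, hK, star_smul, star_mul, hds r hr, star_star]
    simp [mul_sub, sub_mul, mul_assoc, smul_sub]
  have hQ'c : ContinuousOn Q' (Set.Icc s t) :=
    ((hWc.star.mul hKc).mul hWc).const_smul (-Complex.I)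
  set A' : A := star (V t) * A₀ * V t with hA'
  have hA'eq : A' = star (Vi t) * A₀ * Vi t := by
    have h1 := (hVoA t htm).eq
    have h2 := (hVoVi t htm t htm).eq
    have h3 := (Unitary.mem_iff.mp (hVou t htm)).1
    calc A' = star (Vo t) * star (Vi t) * A₀ * (Vi t * Vo t) := by simp [hA', hVdef]
      _ = star (Vo t) * star (Vi t) * (A₀ * Vo t) * Vi t := by rw [← h2]; simp only [mul_assoc]
      _ = star (Vo t) * (star (Vi t) * Vo t) * A₀ * Vi t := by rw [← h1]; simp only [mul_assoc]
      _ = star (Vo t) * (Vo t * star (Vi t)) * A₀ * Vi t := by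
          have h5 := (Unitary.mem_iff.mp (hViu t htm))
          have h4 : star (Vi t) * Vo t = Vo t * star (Vi t) := by
            calc star (Vi t) * Vo t = star (Vi t) * (Vo t * Vi t) * star (Vi t) := by
                  rw [mul_assoc, mul_assoc, h5.2, mul_one]
              _ = _ := by rw [h2, ← mul_assoc, h5.1, one_mul]
          rw [h4]
      _ = _ := by rw [← mul_assoc (star (Vo t)), h3, one_mul]
  have hA'n : ‖A'‖ = ‖A₀‖ := lrf_norm_conj (hVu t htm)
  have hstart : A' * B + ε • (B * A') = 0 := by
    have h1 := (hViB t htm).eq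
    have h5 := (Unitary.mem_iff.mp (hViu t htm))
    have h4 : star (Vi t) * B = B * star (Vi t) := by
      calc star (Vi t) * B = star (Vi t) * (B * Vi t) * star (Vi t) := by
            rw [mul_assoc, mul_assoc, h5.2, mul_one]
        _ = _ := by rw [← h1, ← mul_assoc, h5.1, one_mul]
    have e1 : A' * B = star (Vi t) * (A₀ * B) * Vi t := by
      rw [hA'eq, mul_assoc, h1]; simp only [mul_assoc]
    have e2 : B * A' = star (Vi t) * (B * A₀) * Vi t := by
      rw [hA'eq, ← mul_assoc, ← mul_assoc, ← h4]; simp only [mul_assoc]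
    rw [e1, e2]
    calc _ = star (Vi t) * (A₀ * B + ε • (B * A₀)) * Vi t := by
          simp [mul_add, add_mul]
      _ = 0 := by rw [hAB]; simp
  set F : ℝ → A := fun r => A' * Q r + ε • (Q r * A') with hF
  set F' : ℝ → A := fun r => A' * Q' r + ε • (Q' r * A') with hF'
  have hFd : ∀ r ∈ Set.Icc s t, HasDerivWithinAt F (F' r) (Set.Icc s t) r := fun r hr =>
    ((hQ r hr).const_mul A').add (((hQ r hr).mul_const A').const_smul ε)
  have hF'c : ContinuousOn F' (Set.Icc s t) :=
    (continuousOn_const.mul hQ'c).add ((hQ'c.mul continuousOn_const).const_smul ε)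
  have hFs : F s = 0 := by
    simp only [hF, hQdef, hWdef, hVdef, hU0, hVi0, hVo0]
    simpa using hstart
  have hFt : ‖F t‖ = ‖(star (U t) * A₀ * U t) * B + ε • (B * (star (U t) * A₀ * U t))‖ := by
    have h5 := (Unitary.mem_iff.mp (hVu t htm))
    have h6 := (Unitary.mem_iff.mp (hUu t htm))
    rw [← lrf_norm_conj (hWu t htm) (Q := (star (U t) * A₀ * U t) * B +
      ε • (B * (star (U t) * A₀ * U t)))]
    congr 1
    have e0 : star (U t) * A₀ * U t = W t * A' * star (W t) := by
      simp only [hWdef, hA', star_mul, star_star]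
      calc star (U t) * A₀ * U t = star (U t) * (V t * star (V t)) * A₀ * (V t * star (V t)) * U t := by
            rw [h5.2]; simp
        _ = _ := by simp only [mul_assoc]
    have h7 := (Unitary.mem_iff.mp (hWu t htm))
    rw [e0]
    simp only [hF, hQdef]
    rw [mul_add, add_mul, mul_smul_comm, smul_mul_assoc]
    congr 1
    · simp only [← mul_assoc]
      rw [h7.1, one_mul]
    · simp only [mul_assoc]
      rw [h7.1, mul_one]
  have hFtc : ∫ r in s..t, F' r = F t - F s :=
    intervalIntegral.integral_eq_sub_of_hasDerivAt_of_le hst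
      (fun r hr => (hFd r hr).continuousWithinAt)
      (fun r hr => (hFd r ⟨hr.1.le, hr.2.le⟩).hasDerivAt (Icc_mem_nhds hr.1 hr.2))
      (hF'c.intervalIntegrable_of_Icc hst)
  rw [hFs, sub_zero] at hFtc
  rw [← hFt, ← hFtc, ← intervalIntegral.integral_const_mul]
  refine intervalIntegral.norm_integral_le_of_norm_le hst ?_ (hb.const_mul _)
  refine Filter.Eventually.of_forall fun r hr => ?_
  have hr' : r ∈ Set.Icc s t := ⟨hr.1.le, hr.2⟩
  have hQn : ‖Q' r‖ ≤ b r := by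
    simp only [hQ'def]
    rw [norm_smul, norm_neg, Complex.norm_I, one_mul, lrf_norm_conj (hWu r hr')]
    exact hbound r hr'
  simp only [hF']
  refine (norm_add_le _ _).trans ?_
  rw [norm_smul, hε, one_mul]
  have e1 := norm_mul_le A' (Q' r)
  have e2 := norm_mul_le (Q' r) A'
  rw [hA'n] at e1 e2
  have := norm_nonneg A₀
  nlinarith
end
theorem lrf_monomial_comm {Γ A : Type*} [Ring A] [StarRing A] {a : Γ → A}
    (g : A) (l : List Γ) (k : Γ → Fin 4)
    (hg : ∀ x ∈ l, a x * g = - (g * a x) ∧ star (a x) * g = -(g * star (a x))) :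
    carMonomial a l k * g = (-1) ^ (carOddCount l k) * (g * carMonomial a l k) := by
  induction l with
  | nil => simp [carMonomial, carOddCount]
  | cons x l ih =>
    have ih' := ih (fun y hy => hg y (List.mem_cons_of_mem _ hy))
    obtain ⟨h1, h2⟩ := hg x List.mem_cons_self
    have hm : carMonomial a (x :: l) k = carFactor a (k x) x * carMonomial a l k := by
      simp [carMonomial]
    have hf : carFactor a (k x) x * g =
        (-1) ^ (if (k x = 1 ∨ k x = 2) then 1 else 0) * (g * carFactor a (k x) x) := by
      generalize k x = j
      fin_cases j
      · simp [carFactor]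
      · simp [carFactor, h1]
      · simp [carFactor, h2]
      · simp [carFactor, mul_assoc, h1]
        rw [← mul_assoc, h2]; simp [mul_assoc]
    have hc : carOddCount (x :: l) k = carOddCount l k + (if (k x = 1 ∨ k x = 2) then 1 else 0) := by
      simp [carOddCount, List.countP_cons]
    have hcm : ∀ (n : ℕ) (z : A), (-1) ^ n * z = z * (-1) ^ n := fun n z =>
      ((Commute.neg_one_left z).pow_left n).eq
    rw [hm, mul_assoc, ih', hc, pow_add, ← mul_assoc, ← hcm, mul_assoc, ← mul_assoc _ g, hf]
    simp only [mul_assoc]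

theorem lrf_even_commute {Γ A : Type*} [Ring A] [StarRing A] [Algebra ℂ A] {a : Γ → A}
    (h : IsCAR a) {Z Y : Finset Γ} (hZY : Disjoint Z Y) {P Q : A}
    (hP : P ∈ carSpanEven a Z) (hQ : Q ∈ carSpan a Y) : Commute P Q := by
  obtain ⟨c1, c2, c3⟩ := h
  have hgen : ∀ y ∈ Y, Commute P (a y) ∧ Commute P (star (a y)) := by
    intro y hy
    unfold carSpanEven at hP
    induction hP using Submodule.span_induction with
    | mem m hm =>
      obtain ⟨l, k, -, hl, hev, rfl⟩ := hm
      have hne : ∀ x ∈ l, x ≠ y := by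
        intro x hx hxy
        have : x ∈ Z := by rw [← hl]; simpa using hx
        exact Finset.disjoint_left.mp hZY this (hxy ▸ hy)
      constructor
      · have := lrf_monomial_comm (a y) l k (fun x hx => by
          refine ⟨eq_neg_of_add_eq_zero_left (c1 x y), eq_neg_of_add_eq_zero_right ?_⟩
          have := c3 y x
          rwa [if_neg (Ne.symm (hne x hx))] at this)
        rw [hev.neg_one_pow, one_mul] at this
        exact this
      · have := lrf_monomial_comm (star (a y)) l k (fun x hx => by
          refine ⟨eq_neg_of_add_eq_zero_left ?_, eq_neg_of_add_eq_zero_left (c2 x y)⟩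
          have := c3 x y
          rwa [if_neg (hne x hx)] at this)
        rw [hev.neg_one_pow, one_mul] at this
        exact this
    | zero => exact ⟨Commute.zero_left _, Commute.zero_left _⟩
    | add x z _ _ hx hz => exact ⟨hx.1.add_left hz.1, hx.2.add_left hz.2⟩
    | smul c x _ hx => exact ⟨hx.1.smul_left c, hx.2.smul_left c⟩
  unfold carSpan at hQ
  induction hQ using Submodule.span_induction with
  | mem m hm =>
    obtain ⟨l, k, -, hl, rfl⟩ := hm
    unfold carMonomial
    refine Commute.list_prod_right _ _ fun z hz => ?_
    obtain ⟨y, hy, rfl⟩ := List.mem_map.mp hz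
    have hyY : y ∈ Y := by rw [← hl]; simpa using hy
    obtain ⟨g1, g2⟩ := hgen y hyY
    generalize k y = j
    fin_cases j
    · exact Commute.one_right _
    · exact g1
    · exact g2
    · exact g2.mul_right g1
  | zero => exact Commute.zero_right _
  | add x z _ _ hx hz => exact hx.add_right hz
  | smul c x _ hx => exact hx.smul_right c

theorem lrf_even_le {Γ A : Type*} [Ring A] [StarRing A] [Algebra ℂ A] {a : Γ → A}
    {Z : Finset Γ} : carSpanEven a Z ≤ carSpan a Z := by
  refine Submodule.span_mono ?_
  rintro m ⟨l, k, h1, h2, -, h3⟩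
  exact ⟨l, k, h1, h2, h3⟩

theorem lrf_count {Γ : Type*} {Λ Y P : Finset Γ} {S : Finset (Finset Γ)} (hS : S ⊆ Λ.powerset)
    {φ : Finset Γ → ℝ} (hφ : ∀ W, 0 ≤ φ W) {G : Γ → Γ → ℝ} (hG : ∀ x y, 0 < G x y)
    {n E : ℝ} (hn : 0 ≤ n) (hE : 0 ≤ E)
    (hsum : ∀ x y, ∑ W ∈ Λ.powerset with x ∈ W ∧ y ∈ W, φ W ≤ n * G x y)
    (hconv : ∀ x y, ∑ w ∈ Λ, G x w * G w y ≤ G x y)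
    (hP : ∀ W ∈ S, φ W ≠ 0 → ∃ x ∈ P, x ∈ W) :
    ∑ W ∈ S, φ W * ∑ w ∈ W, ∑ y ∈ Y, ((if w = y then (1 : ℝ) else 0) + E * G w y) ≤
      n * (1 + E) * ∑ x ∈ P, ∑ y ∈ Y, G x y := by
  set d : Γ → ℝ := fun w => ∑ y ∈ Y, ((if w = y then (1 : ℝ) else 0) + E * G w y) with hd
  have hd0 : ∀ w, 0 ≤ d w := fun w => Finset.sum_nonneg fun y _ => by
    have := (hG w y).le
    have : 0 ≤ E * G w y := by positivity
    split_ifs <;> linarith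
  have h1 : ∀ W ∈ S, φ W * ∑ w ∈ W, d w ≤
      ∑ x ∈ P, ∑ w ∈ Λ, if x ∈ W ∧ w ∈ W then φ W * d w else 0 := by
    intro W hW
    have hnn : ∀ x w, 0 ≤ if x ∈ W ∧ w ∈ W then φ W * d w else 0 := by
      intro x w; split_ifs
      · exact mul_nonneg (hφ W) (hd0 w)
      · exact le_rfl
    by_cases h0 : φ W = 0
    · rw [h0, zero_mul]
      exact Finset.sum_nonneg fun x _ => Finset.sum_nonneg fun w _ => by simp
    obtain ⟨x, hxP, hxW⟩ := hP W hW h0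
    refine le_trans ?_ (Finset.single_le_sum
      (f := fun x => ∑ w ∈ Λ, if x ∈ W ∧ w ∈ W then φ W * d w else 0)
      (fun x _ => Finset.sum_nonneg fun w _ => hnn x w) hxP)
    simp only [hxW, true_and]
    rw [Finset.mul_sum, ← Finset.sum_filter]
    refine le_of_eq (Finset.sum_congr ?_ fun _ _ => rfl)
    ext w
    simp only [Finset.mem_filter]
    exact ⟨fun h => ⟨Finset.mem_powerset.mp (hS hW) h, h⟩, fun h => h.2⟩
  have h2 : ∀ x, ∑ w ∈ Λ, n * G x w * d w ≤ n * (1 + E) * ∑ y ∈ Y, G x y := by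
    intro x
    have e : ∑ w ∈ Λ, n * G x w * d w =
        n * ∑ y ∈ Y, ((∑ w ∈ Λ, if w = y then G x w else 0) + E * ∑ w ∈ Λ, G x w * G w y) := by
      simp only [hd, Finset.mul_sum]
      rw [Finset.sum_comm]
      refine Finset.sum_congr rfl fun y _ => ?_
      rw [← Finset.sum_add_distrib, Finset.mul_sum]
      refine Finset.sum_congr rfl fun w _ => ?_
      split_ifs <;> ring
    rw [e, mul_assoc, Finset.mul_sum Y (fun y => G x y) (1 + E)]
    refine mul_le_mul_of_nonneg_left (Finset.sum_le_sum fun y _ => ?_) hn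
    have e1 : (∑ w ∈ Λ, if w = y then G x w else 0) ≤ G x y := by
      rw [Finset.sum_ite_eq']
      split_ifs
      · exact le_rfl
      · exact (hG x y).le
    have e2 := mul_le_mul_of_nonneg_left (hconv x y) hE
    linarith
  calc ∑ W ∈ S, φ W * ∑ w ∈ W, d w
      ≤ ∑ W ∈ S, ∑ x ∈ P, ∑ w ∈ Λ, (if x ∈ W ∧ w ∈ W then φ W * d w else 0) :=
        Finset.sum_le_sum h1
    _ ≤ ∑ W ∈ Λ.powerset, ∑ x ∈ P, ∑ w ∈ Λ, (if x ∈ W ∧ w ∈ W then φ W * d w else 0) := by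
        refine Finset.sum_le_sum_of_subset_of_nonneg hS fun W _ _ =>
          Finset.sum_nonneg fun x _ => Finset.sum_nonneg fun w _ => ?_
        split_ifs
        · exact mul_nonneg (hφ W) (hd0 w)
        · exact le_rfl
    _ = ∑ x ∈ P, ∑ w ∈ Λ, (∑ W ∈ Λ.powerset with x ∈ W ∧ w ∈ W, φ W) * d w := by
        rw [Finset.sum_comm]
        refine Finset.sum_congr rfl fun x _ => ?_
        rw [Finset.sum_comm]
        refine Finset.sum_congr rfl fun w _ => ?_
        rw [Finset.sum_mul, Finset.sum_filter]
    _ ≤ ∑ x ∈ P, ∑ w ∈ Λ, n * G x w * d w :=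
        Finset.sum_le_sum fun x _ => Finset.sum_le_sum fun w _ =>
          mul_le_mul_of_nonneg_right (hsum x w) (hd0 w)
    _ ≤ ∑ x ∈ P, n * (1 + E) * ∑ y ∈ Y, G x y := Finset.sum_le_sum fun x _ => h2 x
    _ = _ := by rw [Finset.mul_sum]

section
variable {Γ A : Type*}
    [NormedRing A] [StarRing A] [CStarRing A] [NormedAlgebra ℂ A] [CompleteSpace A]
    [StarModule ℂ A]

theorem lrf_step_int {a : Γ → A} (hCAR : IsCAR a) {Φ : Finset Γ → ℝ → A} {s t : ℝ} (hst : s ≤ t)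
    (hsa : ∀ Z, ∀ r ∈ Set.Icc s t, star (Φ Z r) = Φ Z r)
    (hev : ∀ Z, ∀ r ∈ Set.Icc s t, Φ Z r ∈ carSpanEven a Z)
    (hcont : ∀ Z, ContinuousOn (Φ Z) (Set.Icc s t))
    {Λ : Finset Γ} {U : ℝ → A} (hU0 : U s = 1) (hUu : ∀ r ∈ Set.Icc s t, U r ∈ unitary A)
    (hU : ∀ r ∈ Set.Icc s t,
      HasDerivWithinAt U ((-Complex.I) • ((∑ Z ∈ Λ.powerset, Φ Z r) * U r)) (Set.Icc s t) r)
    {X Y : Finset Γ} (hXY : Disjoint X Y) {A₀ B : A} (hA : A₀ ∈ carSpan a X)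
    (hB : B ∈ carSpan a Y) {ε : ℂ} (hε : ‖ε‖ = 1) (hAB : A₀ * B + ε • (B * A₀) = 0)
    {b : ℝ → ℝ} (hb : IntervalIntegrable b volume s t)
    (hbound : ∀ r ∈ Set.Icc s t,
      ∑ W ∈ Λ.powerset with ¬ W ⊆ X ∧ ¬ Disjoint W X,
        ‖(star (U r) * Φ W r * U r) * B - B * (star (U r) * Φ W r * U r)‖ ≤ b r) :
    ‖(star (U t) * A₀ * U t) * B + ε • (B * (star (U t) * A₀ * U t))‖ ≤
      2 * ‖A₀‖ * ∫ r in s..t, b r := by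
  have hdec : ∀ r, ∑ Z ∈ Λ.powerset, Φ Z r = (∑ Z ∈ Λ.powerset with Z ⊆ X, Φ Z r) +
      (∑ Z ∈ Λ.powerset with ¬ Z ⊆ X ∧ Disjoint Z X, Φ Z r) +
      ∑ Z ∈ Λ.powerset with ¬ Z ⊆ X ∧ ¬ Disjoint Z X, Φ Z r := by
    intro r
    rw [← Finset.sum_filter_add_sum_filter_not Λ.powerset (fun Z => Z ⊆ X), add_assoc]
    congr 1
    rw [← Finset.sum_filter_add_sum_filter_not (Λ.powerset.filter (fun Z => ¬ Z ⊆ X))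
      (fun Z => Disjoint Z X), Finset.filter_filter, Finset.filter_filter]
  refine lrf_step (U := U)
    (Hi := fun r => ∑ Z ∈ Λ.powerset with Z ⊆ X, Φ Z r)
    (Ho := fun r => ∑ Z ∈ Λ.powerset with ¬ Z ⊆ X ∧ Disjoint Z X, Φ Z r)
    (Hd := fun r => ∑ Z ∈ Λ.powerset with ¬ Z ⊆ X ∧ ¬ Disjoint Z X, Φ Z r)
    hst hε hU0 hUu ?_ (continuousOn_finsetSum _ fun Z _ => hcont Z)
    (continuousOn_finsetSum _ fun Z _ => hcont Z) (continuousOn_finsetSum _ fun Z _ => hcont Z)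
    ?_ ?_ ?_ ?_ ?_ ?_ hAB hb ?_
  · intro r hr
    simp only [← hdec]
    exact hU r hr
  · intro r hr
    rw [star_sum]; exact Finset.sum_congr rfl fun Z _ => hsa Z r hr
  · intro r hr
    rw [star_sum]; exact Finset.sum_congr rfl fun Z _ => hsa Z r hr
  · intro r hr
    rw [star_sum]; exact Finset.sum_congr rfl fun Z _ => hsa Z r hr
  · intro r hr r' hr'
    refine Commute.sum_left _ _ _ fun Z hZ => Commute.sum_right _ _ _ fun Z' hZ' => ?_
    have h1 := (Finset.mem_filter.mp hZ).2
    have h2 := (Finset.mem_filter.mp hZ').2.2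
    exact lrf_even_commute hCAR (Finset.disjoint_of_subset_left h1 h2.symm) (hev Z r hr)
      (lrf_even_le (hev Z' r' hr'))
  · intro r hr
    refine Commute.sum_left _ _ _ fun Z hZ => ?_
    exact lrf_even_commute hCAR (Finset.mem_filter.mp hZ).2.2 (hev Z r hr) hA
  · intro r hr
    refine Commute.sum_left _ _ _ fun Z hZ => ?_
    exact lrf_even_commute hCAR (Finset.disjoint_of_subset_left (Finset.mem_filter.mp hZ).2 hXY)
      (hev Z r hr) hB
  · intro r hr
    refine le_trans ?_ (hbound r hr)
    refine le_trans (le_of_eq ?_) (norm_sum_le _ _)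
    simp only [Finset.mul_sum, Finset.sum_mul, Finset.sum_sub_distrib]

theorem lrf_pow_integral (K s r : ℝ) (n : ℕ) :
    ∫ q in s..r, K * ((K * (q - s)) ^ n / (n.factorial : ℝ)) =
      (K * (r - s)) ^ (n + 1) / ((n + 1).factorial : ℝ) := by
  have e : ∀ q, K * ((K * (q - s)) ^ n / (n.factorial : ℝ)) =
      K ^ (n + 1) / (n.factorial : ℝ) * (q - s) ^ n := by
    intro q; rw [mul_pow, pow_succ]; ring
  simp only [e]
  rw [intervalIntegral.integral_const_mul,
    intervalIntegral.integral_comp_sub_right (fun x => x ^ n) s, integral_pow, Nat.factorial_succ,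
    mul_pow]
  have : (n.factorial : ℝ) ≠ 0 := by positivity
  push_cast
  field_simp
  simp

theorem lrf_core {a : Γ → A} (hCAR : IsCAR a) {Φ : Finset Γ → ℝ → A} {s t : ℝ} (hst : s ≤ t)
    (hsa : ∀ Z, ∀ r ∈ Set.Icc s t, star (Φ Z r) = Φ Z r)
    (hev : ∀ Z, ∀ r ∈ Set.Icc s t, Φ Z r ∈ carSpanEven a Z)
    (hcont : ∀ Z, ContinuousOn (Φ Z) (Set.Icc s t))
    {G : Γ → Γ → ℝ} (hG : ∀ x y, 0 < G x y)
    {nΦ : ℝ → ℝ} (hn : ∀ r ∈ Set.Icc s t, 0 ≤ nΦ r) (hni : IntervalIntegrable nΦ volume s t)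
    {Λ : Finset Γ}
    (hsum : ∀ r ∈ Set.Icc s t, ∀ x y,
      ∑ W ∈ Λ.powerset with x ∈ W ∧ y ∈ W, ‖Φ W r‖ ≤ nΦ r * G x y)
    (hconv : ∀ x y, ∑ w ∈ Λ, G x w * G w y ≤ G x y)
    {U : ℝ → A} (hU0 : U s = 1) (hUu : ∀ r ∈ Set.Icc s t, U r ∈ unitary A)
    (hU : ∀ r ∈ Set.Icc s t,
      HasDerivWithinAt U ((-Complex.I) • ((∑ Z ∈ Λ.powerset, Φ Z r) * U r)) (Set.Icc s t) r)
    {X Y P : Finset Γ} (hXY : Disjoint X Y) {A₀ B : A} (hA : A₀ ∈ carSpan a X)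
    (hB : B ∈ carSpan a Y) {ε : ℂ} (hε : ‖ε‖ = 1) (hAB : A₀ * B + ε • (B * A₀) = 0)
    (hP : ∀ W, ¬ W ⊆ X → ¬ Disjoint W X → ∀ r ∈ Set.Icc s t, Φ W r ≠ 0 → ∃ x ∈ P, x ∈ W) :
    ‖(star (U t) * A₀ * U t) * B + ε • (B * (star (U t) * A₀ * U t))‖ ≤
      2 * ‖A₀‖ * ‖B‖ * (Real.exp (2 * ∫ r in s..t, nΦ r) - 1) * ∑ x ∈ P, ∑ y ∈ Y, G x y := by
  set ex : ℝ → ℝ := fun r => Real.exp (2 * ∫ q in s..r, nΦ q) with hex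
  have hex1 : ∀ r ∈ Set.Icc s t, 0 ≤ ex r - 1 := by
    intro r hr
    have : 0 ≤ ∫ q in s..r, nΦ q :=
      intervalIntegral.integral_nonneg hr.1 fun q hq => hn q ⟨hq.1, hq.2.trans hr.2⟩
    have := Real.one_le_exp (x := 2 * ∫ q in s..r, nΦ q) (by positivity)
    simp only [hex]; linarith
  have hni' : ∀ r ∈ Set.Icc s t, IntervalIntegrable nΦ volume s r := fun r hr =>
    hni.mono_set (by rw [Set.uIcc_of_le hr.1, Set.uIcc_of_le hst]; exact Set.Icc_subset_Icc_right hr.2)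
  have hexi : ∀ r ∈ Set.Icc s t, IntervalIntegrable (fun q => nΦ q * ex q) volume s r :=
    fun r hr => (hni' r hr).mul_continuousOn (lrf_exp_cont (hni' r hr))
  set d : Finset Γ → ℝ → ℝ := fun Z r =>
    ∑ z ∈ Z, ∑ y ∈ Y, ((if z = y then (1 : ℝ) else 0) + (ex r - 1) * G z y) with hd
  -- the counting estimate
  have hcount : ∀ (S : Finset (Finset Γ)) (P' : Finset Γ), S ⊆ Λ.powerset → ∀ r ∈ Set.Icc s t,
      (∀ W ∈ S, Φ W r ≠ 0 → ∃ x ∈ P', x ∈ W) →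
      ∑ W ∈ S, ‖Φ W r‖ * d W r ≤ nΦ r * ex r * ∑ x ∈ P', ∑ y ∈ Y, G x y := by
    intro S P' hS r hr hP'
    have := lrf_count (Y := Y) (P := P') hS (φ := fun W => ‖Φ W r‖) (fun W => norm_nonneg _) hG
      (hn r hr) (hex1 r hr) (hsum r hr) hconv (fun W hW h0 => hP' W hW (norm_ne_zero_iff.mp h0))
    simpa using this
  -- uniform bound
  obtain ⟨C, hC⟩ := isCompact_Icc.exists_bound_of_continuousOn (s := Set.Icc s t)
    (f := fun r => ∑ W ∈ Λ.powerset, ‖Φ W r‖) (continuousOn_finsetSum _ fun Z _ => (hcont Z).norm)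
  have hC' : ∀ r ∈ Set.Icc s t, ∑ W ∈ Λ.powerset, ‖Φ W r‖ ≤ C := fun r hr =>
    (Real.le_norm_self _).trans (hC r hr)
  have hC0 : 0 ≤ C := (norm_nonneg _).trans (hC s ⟨le_rfl, hst⟩)
  have htriv : ∀ (D : A), ∀ r ∈ Set.Icc s t,
      ‖(star (U r) * D * U r) * B - B * (star (U r) * D * U r)‖ ≤ ‖D‖ * (2 * ‖B‖) := by
    intro D r hr
    refine (norm_sub_le _ _).trans ?_
    have e1 := norm_mul_le (star (U r) * D * U r) B
    have e2 := norm_mul_le B (star (U r) * D * U r)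
    rw [lrf_norm_conj (hUu r hr)] at e1 e2
    linarith
  have hd0 : ∀ Z, ∀ r ∈ Set.Icc s t, 0 ≤ d Z r := fun Z r hr =>
    Finset.sum_nonneg fun z _ => Finset.sum_nonneg fun y _ => by
      have h1 := mul_nonneg (hex1 r hr) (hG z y).le
      split_ifs <;> linarith
  have hind : ∀ n : ℕ, ∀ (Z : Finset Γ) (D : A), D ∈ carSpanEven a Z → ∀ r ∈ Set.Icc s t,
      ‖(star (U r) * D * U r) * B - B * (star (U r) * D * U r)‖ ≤
        ‖D‖ * (2 * ‖B‖ * (d Z r + (2 * C * (r - s)) ^ n / (n.factorial : ℝ))) := by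
    intro n
    induction n with
    | zero =>
      intro Z D _ r hr
      refine (htriv D r hr).trans ?_
      have := hd0 Z r hr
      refine mul_le_mul_of_nonneg_left ?_ (norm_nonneg _)
      simp only [pow_zero, Nat.factorial_zero, Nat.cast_one, div_one]
      nlinarith [norm_nonneg B]
    | succ n ih =>
      intro Z D hD r hr
      have hrs : 0 ≤ r - s := by linarith [hr.1]
      by_cases hZY : Disjoint Z Y
      · have hcomm := lrf_even_commute hCAR hZY hD hB
        have hsub : Set.Icc s r ⊆ Set.Icc s t := Set.Icc_subset_Icc_right hr.2
        set g : ℝ := ∑ x ∈ Z, ∑ y ∈ Y, G x y with hg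
        set b : ℝ → ℝ := fun q => 2 * ‖B‖ * g * (nΦ q * ex q) +
          ‖B‖ * (2 * C * ((2 * C * (q - s)) ^ n / (n.factorial : ℝ))) with hb
        have hi1 : IntervalIntegrable (fun q => 2 * ‖B‖ * g * (nΦ q * ex q)) volume s r :=
          (hexi r hr).const_mul _
        have hi2 : IntervalIntegrable (fun q =>
          ‖B‖ * (2 * C * ((2 * C * (q - s)) ^ n / (n.factorial : ℝ)))) volume s r := by
          apply Continuous.intervalIntegrable
          fun_prop
        have key := lrf_step_int hCAR hr.1 (fun W q hq => hsa W q (hsub hq))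
          (fun W q hq => hev W q (hsub hq)) (fun W => (hcont W).mono hsub) hU0
          (fun q hq => hUu q (hsub hq)) (fun q hq => (hU q (hsub hq)).mono hsub) hZY
          (lrf_even_le hD) hB (ε := -1) (by simp) (by simp [hcomm.eq]) (b := b) (hi1.add hi2) ?_
        · rw [neg_one_smul, ← sub_eq_add_neg] at key
          refine key.trans ?_
          have hI : ∫ q in s..r, b q = 2 * ‖B‖ * g * ((ex r - 1) / 2) +
              ‖B‖ * ((2 * C * (r - s)) ^ (n + 1) / ((n + 1).factorial : ℝ)) := by
            simp only [hb]
            rw [intervalIntegral.integral_add hi1 hi2, intervalIntegral.integral_const_mul,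
              intervalIntegral.integral_const_mul, lrf_pow_integral, lrf_exp_integral (hni' r hr)]
          have hdg : (ex r - 1) * g ≤ d Z r := by
            simp only [hd, hg, Finset.mul_sum]
            refine Finset.sum_le_sum fun z _ => Finset.sum_le_sum fun y _ => ?_
            split_ifs <;> linarith
          rw [hI]
          have h3 := mul_le_mul_of_nonneg_left hdg
            (mul_nonneg (norm_nonneg D) (norm_nonneg B))
          linarith
        · intro q hq
          have hq' := hsub hq
          set S := Λ.powerset.filter (fun W => ¬ W ⊆ Z ∧ ¬ Disjoint W Z) with hS
          have hqs : 0 ≤ q - s := by linarith [hq.1]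
          have h1 := hcount S Z (Finset.filter_subset _ _) q hq' (by
            intro W hW _
            obtain ⟨x, hx1, hx2⟩ := Finset.not_disjoint_iff.mp (Finset.mem_filter.mp hW).2.2
            exact ⟨x, hx2, hx1⟩)
          have h2 : ∑ W ∈ S, ‖Φ W q‖ ≤ C :=
            (Finset.sum_le_sum_of_subset_of_nonneg (Finset.filter_subset _ _)
              fun _ _ _ => norm_nonneg _).trans (hC' q hq')
          set p : ℝ := (2 * C * (q - s)) ^ n / (n.factorial : ℝ) with hp
          have hp0 : 0 ≤ p := by positivity
          calc _ ≤ ∑ W ∈ S, ‖Φ W q‖ * (2 * ‖B‖ * (d W q + p)) :=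
                Finset.sum_le_sum fun W _ => ih W _ (hev W q hq') q hq'
            _ = 2 * ‖B‖ * (∑ W ∈ S, ‖Φ W q‖ * d W q) + 2 * ‖B‖ * p * ∑ W ∈ S, ‖Φ W q‖ := by
                rw [Finset.mul_sum, Finset.mul_sum, ← Finset.sum_add_distrib]
                exact Finset.sum_congr rfl fun W _ => by ring
            _ ≤ 2 * ‖B‖ * (nΦ q * ex q * g) + 2 * ‖B‖ * p * C := by gcongr
            _ = b q := by simp only [hb]; ring
      · refine (htriv D r hr).trans (mul_le_mul_of_nonneg_left ?_ (norm_nonneg _))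
        obtain ⟨x, hxZ, hxY⟩ := Finset.not_disjoint_iff.mp hZY
        have hp0 : 0 ≤ (2 * C * (r - s)) ^ (n + 1) / ((n + 1).factorial : ℝ) := by positivity
        have h1 : 1 ≤ d Z r := by
          have hnn : ∀ z y, 0 ≤ (if z = y then (1 : ℝ) else 0) + (ex r - 1) * G z y := by
            intro z y
            have h1 := mul_nonneg (hex1 r hr) (hG z y).le
            split_ifs <;> linarith
          refine le_trans ?_ (Finset.single_le_sum (f := fun z => ∑ y ∈ Y,
            ((if z = y then (1 : ℝ) else 0) + (ex r - 1) * G z y))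
            (fun z _ => Finset.sum_nonneg fun y _ => hnn z y) hxZ)
          refine le_trans ?_ (Finset.single_le_sum (f := fun y =>
            ((if x = y then (1 : ℝ) else 0) + (ex r - 1) * G x y)) (fun y _ => hnn x y) hxY)
          have h1 := mul_nonneg (hex1 r hr) (hG x x).le
          simp only [if_true]
          linarith
        nlinarith [norm_nonneg B]
  have hfin : ∀ (Z : Finset Γ) (D : A), D ∈ carSpanEven a Z → ∀ r ∈ Set.Icc s t,
      ‖(star (U r) * D * U r) * B - B * (star (U r) * D * U r)‖ ≤
        ‖D‖ * (2 * ‖B‖ * d Z r) := by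
    intro Z D hD r hr
    have hlim : Filter.Tendsto (fun n : ℕ =>
        ‖D‖ * (2 * ‖B‖ * (d Z r + (2 * C * (r - s)) ^ n / (n.factorial : ℝ)))) Filter.atTop
        (nhds (‖D‖ * (2 * ‖B‖ * (d Z r + 0)))) :=
      (((FloorSemiring.tendsto_pow_div_factorial_atTop _).const_add _).const_mul _).const_mul _
    rw [add_zero] at hlim
    exact ge_of_tendsto' hlim fun n => hind n Z D hD r hr
  have htm : t ∈ Set.Icc s t := ⟨hst, le_rfl⟩
  set g : ℝ := ∑ x ∈ P, ∑ y ∈ Y, G x y with hg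
  have key := lrf_step_int hCAR hst hsa hev hcont hU0 hUu hU hXY hA hB hε hAB
    (b := fun q => 2 * ‖B‖ * g * (nΦ q * ex q)) ((hexi t htm).const_mul _) ?_
  · refine key.trans (le_of_eq ?_)
    rw [intervalIntegral.integral_const_mul, lrf_exp_integral hni]
    ring
  · intro q hq
    have h1 := hcount (Λ.powerset.filter (fun W => ¬ W ⊆ X ∧ ¬ Disjoint W X)) P
      (Finset.filter_subset _ _) q hq (fun W hW h0 =>
        hP W (Finset.mem_filter.mp hW).2.1 (Finset.mem_filter.mp hW).2.2 q hq h0)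
    calc _ ≤ ∑ W ∈ Λ.powerset with ¬ W ⊆ X ∧ ¬ Disjoint W X, ‖Φ W q‖ * (2 * ‖B‖ * d W q) :=
          Finset.sum_le_sum fun W _ => hfin W _ (hev W q hq) q hq
      _ = 2 * ‖B‖ * (∑ W ∈ Λ.powerset with ¬ W ⊆ X ∧ ¬ Disjoint W X, ‖Φ W q‖ * d W q) := by
          rw [Finset.mul_sum]
          exact Finset.sum_congr rfl fun W _ => by ring
      _ ≤ 2 * ‖B‖ * (nΦ q * ex q * g) := by gcongr
      _ = _ := by ring
end

end LRFAux

open MeasureTheory in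
/-- Lieb-Robinson bound for lattice fermions, anticommutator version. -/
theorem lieb_robinson_fermions_anticommutator
    {Γ A : Type*} [Countable Γ]
    [NormedRing A] [StarRing A] [CStarRing A] [NormedAlgebra ℂ A] [CompleteSpace A]
    (a : Γ → A) (hCAR : IsCAR a)
    -- the interval `I`
    (I : Set ℝ) (hI : I.OrdConnected)
    -- the even, time-dependent interaction `Φ ∈ B_G⁺(I)`
    (Φ : Finset Γ → ℝ → A)
    (hΦsa : ∀ Z : Finset Γ, ∀ t ∈ I, star (Φ Z t) = Φ Z t)
    (hΦeven : ∀ Z : Finset Γ, ∀ t ∈ I, Φ Z t ∈ carSpanEven a Z)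
    (hΦcont : ∀ Z : Finset Γ, ContinuousOn (Φ Z) I)
    -- the decay function `G`
    (G : Γ → Γ → ℝ)
    (hGpos : ∀ x y, 0 < G x y)
    (hGsymm : ∀ x y, G x y = G y x)
    (hGsum : ∀ x, Summable (G x))
    (hGconv : ∀ x y, Summable (fun z => G x z * G z y) ∧ ∑' z, G x z * G z y ≤ G x y)
    (hGbdd : ∃ M : ℝ, ∀ x, ∑' z, G x z ≤ M)
    -- the (time-dependent) interaction norm `‖Φ‖_G`, locally integrable on `I`
    (nΦ : ℝ → ℝ)
    (hnΦ : ∀ t ∈ I, 0 ≤ nΦ t)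
    (hnΦint : ∀ s ∈ I, ∀ t ∈ I, IntervalIntegrable nΦ volume s t)
    (hΦG : ∀ x y : Γ, ∀ t ∈ I,
      Summable (fun Z : {Z : Finset Γ // x ∈ Z ∧ y ∈ Z} => ‖Φ Z.1 t‖) ∧
      ∑' Z : {Z : Finset Γ // x ∈ Z ∧ y ∈ Z}, ‖Φ Z.1 t‖ ≤ nΦ t * G x y)
    -- the finite volume `Λ` and the unitary propagator `U_Λ(t,s)` generated by
    -- `H_Λ(t) = ∑_{Z ⊆ Λ} Φ(Z,t)`
    (Λ : Finset Γ)
    (U : ℝ → ℝ → A)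
    (hUunitary : ∀ s ∈ I, ∀ t ∈ I, U t s ∈ unitary A)
    (hUmem : ∀ s ∈ I, ∀ t ∈ I, U t s ∈ carSpan a Λ)
    (hUinit : ∀ s ∈ I, U s s = 1)
    (hUode : ∀ s ∈ I, ∀ t ∈ I,
      HasDerivWithinAt (fun r => U r s)
        ((-Complex.I) • ((∑ Z ∈ Λ.powerset, Φ Z t) * U t s)) I t)
    -- disjoint supports `X, Y ⊆ Λ` and observables `A₀ ∈ 𝔄_X`, `B₀ ∈ 𝔄_Y`
    (X Y : Finset Γ) (hXΛ : X ⊆ Λ) (hYΛ : Y ⊆ Λ) (hXY : Disjoint X Y)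
    (A₀ B₀ : A) (hA : A₀ ∈ carSpan a X) (hB : B₀ ∈ carSpan a Y)
    (hanticomm : A₀ * B₀ + B₀ * A₀ = 0)
    (s t : ℝ) (hs : s ∈ I) (ht : t ∈ I) (hst : s ≤ t) :
    ‖(star (U t s) * A₀ * U t s) * B₀ + B₀ * (star (U t s) * A₀ * U t s)‖ ≤
      2 * ‖A₀‖ * ‖B₀‖ * (Real.exp (2 * ∫ r in s..t, nΦ r) - 1) *
        ∑ x ∈ X.filter (fun x => ∃ Z : Finset Γ, ∃ t' ∈ I,
            x ∈ Z ∧ (Z ∩ X).Nonempty ∧ (Z \ X).Nonempty ∧ Φ Z t' ≠ 0),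
          ∑ y ∈ Y, G x y := by
  rcases isEmpty_or_nonempty Γ with hΓ | ⟨⟨x₀⟩⟩
  · -- no sites: every observable is a scalar
    have hX : X = ∅ := Finset.eq_empty_of_isEmpty X
    have hcen : ∀ C : A, Commute A₀ C := by
      intro C
      clear hanticomm
      unfold carSpan at hA
      induction hA using Submodule.span_induction with
      | mem m hm =>
        obtain ⟨l, k, -, hl, rfl⟩ := hm
        have : l = [] := List.eq_nil_iff_forall_not_mem.mpr fun x => isEmptyElim x
        subst this
        simp [carMonomial]
      | zero => exact Commute.zero_left _
      | add x z _ _ hx hz => exact hx.add_left hz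
      | smul c x _ hx => exact hx.smul_left c
    have hUU := (Unitary.mem_iff.mp (hUunitary s hs t ht)).1
    have : star (U t s) * A₀ * U t s = A₀ := by
      rw [mul_assoc, (hcen (U t s)).eq, ← mul_assoc, hUU, one_mul]
    rw [this, hanticomm]
    simp [hX]
  · have hsm : StarModule ℂ A := by
      refine lrf_starModule (lrf_starI (a x₀) ?_ ?_)
      · have h := hCAR.1 x₀ x₀
        rw [← two_smul ℂ (a x₀ * a x₀)] at h
        exact (smul_eq_zero.mp h).resolve_left two_ne_zero
      · simpa using hCAR.2.2 x₀ x₀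
    have hJ : Set.Icc s t ⊆ I := hI.out hs ht
    have key := lrf_core hCAR (Φ := Φ) hst (fun Z r hr => hΦsa Z r (hJ hr))
      (fun Z r hr => hΦeven Z r (hJ hr)) (fun Z => (hΦcont Z).mono hJ) hGpos
      (fun r hr => hnΦ r (hJ hr)) (hnΦint s hs t ht) (Λ := Λ) ?_ ?_ (U := fun r => U r s)
      (hUinit s hs) (fun r hr => hUunitary s hs r (hJ hr))
      (fun r hr => (hUode s hs r (hJ hr)).mono hJ) (P := X.filter (fun x => ∃ Z : Finset Γ, ∃ t' ∈ I,
            x ∈ Z ∧ (Z ∩ X).Nonempty ∧ (Z \ X).Nonempty ∧ Φ Z t' ≠ 0))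
      hXY hA hB (ε := 1) (by simp) (by simpa using hanticomm) ?_
    · simpa only [one_smul] using key
    · intro r hr x y
      obtain ⟨h1, h2⟩ := hΦG x y r (hJ hr)
      refine le_trans ?_ h2
      have h3 := h1.sum_le_tsum ((Λ.powerset.filter (fun W => x ∈ W ∧ y ∈ W)).subtype
        (fun W => x ∈ W ∧ y ∈ W)) (fun _ _ => norm_nonneg _)
      refine le_trans (le_of_eq ?_) h3
      rw [Finset.sum_subtype_of_mem (fun W => ‖Φ W r‖)]
      intro W hW
      exact (Finset.mem_filter.mp hW).2
    · intro x y
      obtain ⟨h1, h2⟩ := hGconv x y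
      exact (h1.sum_le_tsum Λ fun z _ => (mul_pos (hGpos x z) (hGpos z y)).le).trans h2
    · intro W hW1 hW2 r hr h0
      obtain ⟨x, hxW, hxX⟩ := Finset.not_disjoint_iff.mp hW2
      refine ⟨x, Finset.mem_filter.mpr ⟨hxX, W, r, hJ hr, hxW, ⟨x, Finset.mem_inter.mpr ⟨hxW, hxX⟩⟩,
        ?_, h0⟩, hxW⟩
      exact Finset.sdiff_nonempty.mpr hW1
end

section
/- One-step locality estimate, commutator version: Let Φ be an even time-dependent interaction on Γ, Λ ⊆ Γ finite, X ⊆ Λ, A ∈ 𝔄_X, B ∈ 𝔄_Λ, and s, t ∈ I with s ≤ t. Then ‖[τ_{t,s}^Λ(A), B]‖ ≤ ‖[τ_{t,s}^X(A), B]‖ + 2‖A‖ ∑_{Z ∈ S_Λ(X)} ∫_s^t ‖[τ_{r,s}^Λ(Φ(Z,r)), B]‖ dr, where τ^X is the Heisenberg dynamics generated by H_X(t) = ∑_{Z ⊆ X} Φ(Z,t). -/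
open scoped Classical

section HelperLemmas

variable {Γ A : Type*}

/-- In the presence of one CAR generator the star operation is automatically conjugate-linear. -/
theorem car_star_I [NormedRing A] [StarRing A] [CStarRing A] [NormedAlgebra ℂ A]
    (a : Γ → A) (hCAR : IsCAR a) (x : Γ) (P : A) (hP : star P = P) :
    star (Complex.I • P) = -(Complex.I • P) := by
  obtain ⟨h1, h2, h3⟩ := hCAR
  set j : A := algebraMap ℂ A Complex.I with hj
  set k : A := star j with hk
  have jc : ∀ y : A, j * y = y * j := fun y => Algebra.commutes Complex.I y
  have kc : ∀ y : A, k * y = y * k := by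
    intro y
    have := congrArg star (jc (star y))
    simpa [star_mul] using this.symm
  have jj : j * j = -1 := by
    rw [hj, ← map_mul, Complex.I_mul_I]; simp
  have kk : k * k = -1 := by
    rw [hk, ← star_mul, jj]; simp
  set b := a x with hb
  set c := star b with hc
  have bb0 : b * b + b * b = 0 := h1 x x
  have two : ∀ y : A, y + y = 0 → y = 0 := by
    intro y hy
    have : (2 : ℂ) • y = 0 := by rw [two_smul, hy]
    exact (smul_eq_zero.mp this).resolve_left two_ne_zero
  have bb : b * b = 0 := two _ bb0
  have cc : c * c = 0 := two _ (h2 x x)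
  have bc : b * c + c * b = 1 := by simpa using h3 x x
  set h := b + c with hh
  set n := b * c - c * b with hn
  have sh : star h = h := by simp [hh, hc, add_comm]
  have sn : star n = n := by simp [hn, hc]
  have hsq : h * h = 1 := by
    rw [hh, add_mul, mul_add, mul_add, bb, cc, zero_add, add_zero, bc]
  have cb : c * b = 1 - b * c := eq_sub_of_add_eq' bc
  have bcb : b * c * b = b := by
    rw [mul_assoc, cb, mul_sub, mul_one, ← mul_assoc, bb, zero_mul, sub_zero]
  have cbc : c * b * c = c := by
    rw [cb, sub_mul, one_mul, mul_assoc, cc, mul_zero, sub_zero]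
  have nsq : n * n = 1 := by
    have e1 : b * c * (b * c) = b * c := by rw [← mul_assoc, bcb]
    have e2 : c * b * (c * b) = c * b := by rw [← mul_assoc, cbc]
    have e3 : b * c * (c * b) = 0 := by rw [mul_assoc, ← mul_assoc c, cc]; simp
    have e4 : c * b * (b * c) = 0 := by rw [mul_assoc, ← mul_assoc b, bb]; simp
    rw [hn, sub_mul, mul_sub, mul_sub, e1, e2, e3, e4, ← bc]; abel
  have hnn : h * n = -(n * h) := by
    have e1 : b * (b * c) = 0 := by rw [← mul_assoc, bb, zero_mul]
    have e2 : b * (c * b) = b := by rw [← mul_assoc, bcb]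
    have e3 : c * (b * c) = c := by rw [← mul_assoc, cbc]
    have e4 : c * (c * b) = 0 := by rw [← mul_assoc, cc, zero_mul]
    have e5 : b * c * c = 0 := by rw [mul_assoc, cc, mul_zero]
    have e6 : c * b * b = 0 := by rw [mul_assoc, bb, mul_zero]
    rw [hh, hn]
    simp only [add_mul, mul_add, sub_mul, mul_sub, e1, e2, e3, e4, e5, e6, bcb, cbc]
    abel
  have sk : star k = j := by simp [hk]
  clear_value h n
  have hx : star ((j + k) * (h + j * n)) * ((j + k) * (h + j * n)) = 0 := by
    have e0 : star ((j + k) * (h + j * n)) = (h + k * n) * (j + k) := by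
      rw [star_mul, star_add, star_add, star_mul, sh, sn, sk, ← hk, add_comm k j, ← kc n]
    have e1 : (h + k * n) * (j + k) * ((j + k) * (h + j * n))
        = (j + k) * ((j + k) * ((h + k * n) * (h + j * n))) := by
      have cm : ∀ y, y * (j + k) = (j + k) * y := by
        intro y; rw [mul_add, add_mul, jc, kc]
      rw [cm, mul_assoc, ← mul_assoc (h + k * n), cm (h + k * n), mul_assoc]
    have e2 : (h + k * n) * (h + j * n) = (1 + k * j) + (j - k) * (h * n) := by
      have f1 : h * (j * n) = j * (h * n) := by rw [← mul_assoc, ← jc, mul_assoc]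
      have f2 : k * n * h = -(k * (h * n)) := by rw [hnn, mul_neg, neg_neg, mul_assoc]
      have f3 : k * n * (j * n) = k * j := by
        rw [mul_assoc, ← mul_assoc n, ← jc n, mul_assoc j, nsq, mul_one]
      rw [add_mul, mul_add, mul_add, hsq, f1, f2, f3, sub_mul]; abel
    have e3 : (j + k) * (1 + k * j) = 0 := by
      have f1 : j * (k * j) = -k := by rw [jc, mul_assoc, jj]; simp
      have f2 : k * (k * j) = -j := by rw [← mul_assoc, kk]; simp
      rw [add_mul, mul_add, mul_add, f1, f2]; simp
    have e4 : (j + k) * (j - k) = 0 := by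
      rw [add_mul, mul_sub, mul_sub, jj, kk, jc k]; abel
    rw [e0, e1, e2, mul_add (j + k), e3, ← mul_assoc (j + k) (j - k), e4]
    simp
  have hx0 : (j + k) * (h + j * n) = 0 := CStarRing.star_mul_self_eq_zero_iff _ |>.mp hx
  have hjk : j + k = 0 := by
    apply two
    have r1 : (j + k) * (h + j * n) * h + h * ((j + k) * (h + j * n)) = (j + k) + (j + k) := by
      have cm : ∀ y, y * (j + k) = (j + k) * y := by
        intro y; rw [mul_add, add_mul, jc, kc]
      have f1 : h * ((j + k) * (h + j * n)) = (j + k) * (h * (h + j * n)) := by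
        rw [← mul_assoc, cm, mul_assoc]
      have f2 : h * (j * n) = -(j * n * h) := by
        rw [← mul_assoc, ← jc, mul_assoc, hnn, mul_neg, mul_assoc]
      rw [f1, mul_assoc, ← mul_add, add_mul h, mul_add h, f2, hsq, ← mul_two (j + k)]
      congr 1
      rw [show (1 : A) + j * n * h + (1 + -(j * n * h)) = 1 + 1 by abel]
      norm_num
    rw [← r1, hx0]; simp
  have hkj : k = -j := (neg_eq_of_add_eq_zero_right hjk).symm
  rw [Algebra.smul_def, star_mul, hP, ← hj, ← hk, hkj, mul_neg, ← jc]

/-- Sign picked up by moving an odd element through a monomial. -/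
theorem car_move [Ring A] [StarRing A] (a : Γ → A) (c : A) (l : List Γ) (k : Γ → Fin 4)
    (h1 : ∀ y ∈ l, c * a y = -(a y * c)) (h2 : ∀ y ∈ l, c * star (a y) = -(star (a y) * c)) :
    c * carMonomial a l k = (-1) ^ carOddCount l k * (carMonomial a l k * c) := by
  induction l with
  | nil => simp [carMonomial, carOddCount]
  | cons y l ih =>
    have ih' := ih (fun z hz => h1 z (by simp [hz])) (fun z hz => h2 z (by simp [hz]))
    have g1 := h1 y (by simp)
    have g2 := h2 y (by simp)
    have em : carMonomial a (y :: l) k = carFactor a (k y) y * carMonomial a l k := by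
      simp [carMonomial]
    have ec : carOddCount (y :: l) k
        = carOddCount l k + if (k y = 1 ∨ k y = 2) then 1 else 0 := by
      simp [carOddCount, List.countP_cons]
    have key : c * carFactor a (k y) y
        = (-1) ^ (if (k y = 1 ∨ k y = 2) then 1 else 0) * (carFactor a (k y) y * c) := by
      generalize k y = m
      fin_cases m
      · simp [carFactor]
      · simpa [carFactor] using g1
      · simpa [carFactor] using g2
      · simp only [carFactor]
        simp [← mul_assoc, g2]
        simp [mul_assoc, g1]
    have sc : ∀ (m : ℕ) (z : A), z * (-1) ^ m = (-1) ^ m * z := fun m z =>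
      ((Commute.neg_one_right z).pow_right m).eq
    rw [em, ec, ← mul_assoc, key, pow_add, mul_assoc, mul_assoc, ih']
    rw [← mul_assoc (carFactor a (k y) y), sc, ← mul_assoc, ← mul_assoc, ← mul_assoc,
      sc]
    simp only [mul_assoc]

theorem car_even_commute [Ring A] [StarRing A] [Algebra ℂ A] (a : Γ → A) (hCAR : IsCAR a)
    (Z X : Finset Γ) (hd : Disjoint Z X) (E D : A) (hE : E ∈ carSpanEven a Z)
    (hD : D ∈ carSpan a X) : Commute E D := by
  obtain ⟨h1, h2, h3⟩ := hCAR
  -- generators commute with even elements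
  have gen : ∀ c : A, (∀ y ∈ Z, c * a y = -(a y * c)) →
      (∀ y ∈ Z, c * star (a y) = -(star (a y) * c)) → Commute E c := by
    intro c hc1 hc2
    unfold carSpanEven at hE
    induction hE using Submodule.span_induction with
    | mem m hm =>
      obtain ⟨l, k, -, hl, hev, rfl⟩ := hm
      have := car_move a c l k (fun y hy => hc1 y (by rw [← hl]; simpa using hy))
        (fun y hy => hc2 y (by rw [← hl]; simpa using hy))
      rw [hev.neg_one_pow, one_mul] at this
      exact this.symm
    | zero => exact Commute.zero_left _
    | add x y _ _ hx hy => exact hx.add_left hy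
    | smul z x _ hx => exact hx.smul_left z
  have ne : ∀ x ∈ X, ∀ y ∈ Z, x ≠ y := by
    rintro x hx y hy rfl
    exact Finset.disjoint_left.mp hd hy hx
  have ga : ∀ x ∈ X, Commute E (a x) := fun x hx => gen _
    (fun y _ => eq_neg_of_add_eq_zero_left (h1 x y))
    (fun y hy => eq_neg_of_add_eq_zero_left (by rw [h3 x y, if_neg (ne x hx y hy)]))
  have gs : ∀ x ∈ X, Commute E (star (a x)) := fun x hx => gen _
    (fun y hy => eq_neg_of_add_eq_zero_left
      (by rw [add_comm, h3 y x, if_neg (ne x hx y hy).symm]))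
    (fun y _ => eq_neg_of_add_eq_zero_left (h2 x y))
  unfold carSpan at hD
  induction hD using Submodule.span_induction with
  | mem m hm =>
    obtain ⟨l, k, -, hl, rfl⟩ := hm
    have hmem : ∀ x ∈ l, x ∈ X := fun x hx => by rw [← hl]; simpa using hx
    clear hl
    unfold carMonomial
    apply Commute.list_prod_right
    intro y hy
    obtain ⟨x, hx, rfl⟩ := List.mem_map.mp hy
    have hxX := hmem x hx
    generalize k x = m
    fin_cases m
    · exact Commute.one_right _
    · exact ga x hxX
    · exact gs x hxX
    · exact (gs x hxX).mul_right (ga x hxX)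
  | zero => exact Commute.zero_right _
  | add x y _ _ hx hy => exact hx.add_right hy
  | smul z x _ hx => exact hx.smul_right z

theorem hasDeriv_star_unitary [NormedRing A] [StarRing A] [NormedAlgebra ℂ A]
    [CompleteSpace A] (u : ℝ → A) (u' : A) (I : Set ℝ) (r : ℝ) (hr : r ∈ I)
    (hu : ∀ r ∈ I, u r ∈ unitary A) (h : HasDerivWithinAt u u' I r) :
    HasDerivWithinAt (fun r => star (u r)) (-(star (u r) * u' * star (u r))) I r := by
  have inv : ∀ r ∈ I, star (u r) = Ring.inverse (u r) := by
    intro r hr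
    have := Ring.inverse_unit (Unitary.toUnits ⟨u r, hu r hr⟩)
    exact this.symm
  have h1 := hasFDerivAt_ringInverse (𝕜 := ℝ) (Unitary.toUnits ⟨u r, hu r hr⟩)
  have h2 := HasFDerivAt.comp_hasDerivWithinAt (f := u) r h1 h
  refine HasDerivWithinAt.congr ?_ inv (inv r hr)
  convert h2 using 1
  · rfl
  · rfl

theorem norm_skew_step [NormedRing A] [StarRing A] [CStarRing A] [NormedAlgebra ℂ A] [Nontrivial A]
    (R f : A) (hR : star R = -R) (h : ℝ) :
    ‖f + h • (R * f - f * R)‖ ≤ ‖f‖ + h ^ 2 * (2 * ‖R‖ ^ 2 * ‖f‖) := by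
  have sh : star (h • R) = -(h • R) := by
    have := map_real_smul (starAddEquiv (R := A)) continuous_star h R
    simp only [starAddEquiv_apply] at this
    rw [this, hR, smul_neg]
  set T := h • R with hT
  have nT : ‖T‖ ^ 2 = h ^ 2 * ‖R‖ ^ 2 := by
    rw [hT, norm_smul, mul_pow, Real.norm_eq_abs, sq_abs]
  have b1 : ‖1 + T‖ * ‖1 + T‖ ≤ 1 + ‖T‖ ^ 2 := by
    rw [← CStarRing.norm_star_mul_self, star_add, star_one, sh,
      show (1 + -T) * (1 + T) = 1 - T * T by noncomm_ring]
    calc _ ≤ ‖(1 : A)‖ + ‖T * T‖ := norm_sub_le _ _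
      _ ≤ 1 + ‖T‖ ^ 2 := by
        rw [CStarRing.norm_one, sq]; gcongr; exact norm_mul_le _ _
  have b2 : ‖1 - T‖ = ‖1 + T‖ := by
    rw [← norm_star (1 + T), star_add, star_one, sh, sub_eq_add_neg]
  have e : f + h • (R * f - f * R) = (1 + T) * f * (1 - T) + T * f * T := by
    rw [smul_sub, ← smul_mul_assoc, ← mul_smul_comm, ← hT]; noncomm_ring
  rw [e]
  calc _ ≤ ‖(1 + T) * f * (1 - T)‖ + ‖T * f * T‖ := norm_add_le _ _
    _ ≤ ‖1 + T‖ * ‖f‖ * ‖1 - T‖ + ‖T‖ * ‖f‖ * ‖T‖ := by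
      gcongr <;> exact norm_mul₃_le
    _ = (‖1 + T‖ * ‖1 + T‖) * ‖f‖ + ‖T‖ ^ 2 * ‖f‖ := by rw [b2]; ring
    _ ≤ (1 + ‖T‖ ^ 2) * ‖f‖ + ‖T‖ ^ 2 * ‖f‖ := by gcongr
    _ = _ := by rw [nT]; ring

theorem norm_evol_le [NormedRing A] [StarRing A] [CStarRing A] [NormedAlgebra ℂ A] [Nontrivial A]
    (f R Q : ℝ → A) (φ : ℝ → ℝ) (s t : ℝ) (hst : s ≤ t)
    (hφ : ContinuousOn φ (Set.Icc s t))
    (hR : ∀ r ∈ Set.Icc s t, star (R r) = -R r)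
    (hQ : ∀ r ∈ Set.Icc s t, ‖Q r‖ ≤ φ r)
    (hf : ∀ r ∈ Set.Icc s t,
      HasDerivWithinAt f (R r * f r - f r * R r + Q r) (Set.Icc s t) r) :
    ‖f t‖ ≤ ‖f s‖ + ∫ r in s..t, φ r := by
  have hfc : ContinuousOn f (Set.Icc s t) := fun r hr => (hf r hr).continuousWithinAt
  have hint : ∀ r ∈ Set.Icc s t, IntervalIntegrable φ MeasureTheory.volume s r := by
    intro r hr
    apply ContinuousOn.intervalIntegrable
    rw [Set.uIcc_of_le hr.1]
    exact hφ.mono (Set.Icc_subset_Icc_right hr.2)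
  have main := image_le_of_liminf_slope_right_le_deriv_boundary
    (f := fun r => ‖f r‖) (a := s) (b := t) hfc.norm
    (B := fun r => ‖f s‖ + ∫ u in s..r, φ u) (B' := φ) (by simp) ?_ ?_ ?_
  · exact main ⟨hst, le_rfl⟩
  · refine continuousOn_const.add ?_
    have := intervalIntegral.continuousOn_primitive_interval
      (f := φ) (μ := MeasureTheory.volume) (a := s) (b := t)
      (by rw [Set.uIcc_of_le hst]; exact hφ.integrableOn_Icc)
    rwa [Set.uIcc_of_le hst] at this
  · intro r hr
    refine HasDerivWithinAt.const_add _ ?_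
    have hr' : r ∈ Set.Icc s t := ⟨hr.1, hr.2.le⟩
    have hnh : Set.Icc s t ∈ nhdsWithin r (Set.Ioi r) :=
      Filter.mem_of_superset (Ioo_mem_nhdsGT hr.2)
        (fun z hz => ⟨hr.1.trans hz.1.le, hz.2.le⟩)
    refine intervalIntegral.integral_hasDerivWithinAt_right (hint r hr') ?_ ?_
      (t := Set.Ioi r)
    · exact ⟨Set.Icc s t, hnh, (hφ.aestronglyMeasurable measurableSet_Icc)⟩
    · exact (hφ r hr').mono_of_mem_nhdsWithin hnh
  · intro r hr c hc
    apply Filter.Eventually.frequently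
    have hr' : r ∈ Set.Icc s t := ⟨hr.1, hr.2.le⟩
    have hnh : Set.Icc s t ∈ nhdsWithin r (Set.Ioi r) :=
      Filter.mem_of_superset (Ioo_mem_nhdsGT hr.2)
        (fun z hz => ⟨hr.1.trans hz.1.le, hz.2.le⟩)
    have hd : HasDerivWithinAt f (R r * f r - f r * R r + Q r) (Set.Ioi r) r :=
      (hf r hr').mono_of_mem_nhdsWithin hnh
    set ε := (c - φ r) / 2 with hε
    have hεp : 0 < ε := by rw [hε]; linarith
    have ho := (hasDerivWithinAt_iff_isLittleO.mp hd).bound hεp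
    set M := 2 * ‖R r‖ ^ 2 * ‖f r‖ with hM
    have hM0 : 0 ≤ M := by positivity
    have hsmall : ∀ᶠ z in nhdsWithin r (Set.Ioi r), (z - r) * M < ε := by
      have : Filter.Tendsto (fun z : ℝ => (z - r) * M) (nhds r) (nhds ((r - r) * M)) :=
        Continuous.tendsto (by fun_prop) r
      rw [sub_self, zero_mul] at this
      exact nhdsWithin_le_nhds (this.eventually (gt_mem_nhds hεp))
    filter_upwards [ho, hsmall, self_mem_nhdsWithin] with z hz1 hz2 hz3
    have hz : 0 < z - r := sub_pos.mpr hz3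
    rw [slope_def_field, div_lt_iff₀ hz]
    have st := norm_skew_step (R r) (f r) (hR r hr') (z - r)
    rw [Real.norm_of_nonneg hz.le] at hz1
    have hq : ‖(z - r) • Q r‖ ≤ (z - r) * φ r := by
      rw [norm_smul, Real.norm_of_nonneg hz.le]; gcongr; exact hQ r hr'
    have dec : f z = (f z - f r - (z - r) • (R r * f r - f r * R r + Q r))
        + (f r + (z - r) • (R r * f r - f r * R r)) + (z - r) • Q r := by
      rw [smul_add]; abel
    have n3 : ‖f z‖ ≤ ε * (z - r) + (‖f r‖ + (z - r) ^ 2 * M) + (z - r) * φ r := by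
      rw [dec]
      refine (norm_add₃_le).trans ?_
      gcongr
    have : (z - r) ^ 2 * M < (z - r) * ε := by
      rw [sq, mul_assoc]; gcongr
    have : c = φ r + 2 * ε := by rw [hε]; ring
    rw [this]
    nlinarith

end HelperLemmas

open MeasureTheory in
/-- one-step locality estimate, commutator version. -/
theorem one_step_locality_commutator
    {Γ A : Type*} [Countable Γ] [DecidableEq Γ]
    [NormedRing A] [StarRing A] [CStarRing A] [NormedAlgebra ℂ A] [CompleteSpace A]
    (a : Γ → A) (hCAR : IsCAR a)
    -- the interval `I`
    (I : Set ℝ) (hI : I.OrdConnected)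
    -- the even, time-dependent interaction `Φ`
    (Φ : Finset Γ → ℝ → A)
    (hΦsa : ∀ Z : Finset Γ, ∀ t ∈ I, star (Φ Z t) = Φ Z t)
    (hΦeven : ∀ Z : Finset Γ, ∀ t ∈ I, Φ Z t ∈ carSpanEven a Z)
    (hΦcont : ∀ Z : Finset Γ, ContinuousOn (Φ Z) I)
    -- the finite volume `Λ` and the sub-volume `X ⊆ Λ`
    (Λ X : Finset Γ) (hXΛ : X ⊆ Λ)
    -- the unitary propagator `U_Λ(t,s)` generated by `H_Λ(t) = ∑_{Z ⊆ Λ} Φ(Z,t)`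
    (U : ℝ → ℝ → A)
    (hUunitary : ∀ s ∈ I, ∀ t ∈ I, U t s ∈ unitary A)
    (hUmem : ∀ s ∈ I, ∀ t ∈ I, U t s ∈ carSpan a Λ)
    (hUinit : ∀ s ∈ I, U s s = 1)
    (hUode : ∀ s ∈ I, ∀ t ∈ I,
      HasDerivWithinAt (fun r => U r s)
        ((-Complex.I) • ((∑ Z ∈ Λ.powerset, Φ Z t) * U t s)) I t)
    -- the unitary propagator `U_X(t,s)` generated by `H_X(t) = ∑_{Z ⊆ X} Φ(Z,t)`
    (V : ℝ → ℝ → A)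
    (hVunitary : ∀ s ∈ I, ∀ t ∈ I, V t s ∈ unitary A)
    (hVmem : ∀ s ∈ I, ∀ t ∈ I, V t s ∈ carSpan a X)
    (hVinit : ∀ s ∈ I, V s s = 1)
    (hVode : ∀ s ∈ I, ∀ t ∈ I,
      HasDerivWithinAt (fun r => V r s)
        ((-Complex.I) • ((∑ Z ∈ X.powerset, Φ Z t) * V t s)) I t)
    -- the observables `A₀ ∈ 𝔄_X` and `B₀ ∈ 𝔄_Λ`
    (A₀ B₀ : A) (hA : A₀ ∈ carSpan a X) (hB : B₀ ∈ carSpan a Λ)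
    (s t : ℝ) (hs : s ∈ I) (ht : t ∈ I) (hst : s ≤ t) :
    ‖(star (U t s) * A₀ * U t s) * B₀ - B₀ * (star (U t s) * A₀ * U t s)‖ ≤
      ‖(star (V t s) * A₀ * V t s) * B₀ - B₀ * (star (V t s) * A₀ * V t s)‖ +
      2 * ‖A₀‖ *
        ∑ Z ∈ Λ.powerset.filter (fun Z => (Z ∩ X).Nonempty ∧ (Z \ X).Nonempty),
          ∫ r in s..t,
            ‖(star (U r s) * Φ Z r * U r s) * B₀ - B₀ * (star (U r s) * Φ Z r * U r s)‖ := by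
  classical
  rcases isEmpty_or_nonempty Γ with hΓ | ⟨⟨x₀⟩⟩
  · -- without sites every observable is a scalar
    have hBc : ∀ y : A, Commute y B₀ := by
      intro y
      unfold carSpan at hB
      induction hB using Submodule.span_induction with
      | mem m hm =>
        obtain ⟨l, k, -, -, rfl⟩ := hm
        have hl : l = [] := by
          cases l with
          | nil => rfl
          | cons z _ => exact (hΓ.false z).elim
        subst hl
        simp [carMonomial]
      | zero => exact Commute.zero_right _
      | add x y _ _ hx hy => exact hx.add_right hy
      | smul z x _ hx => exact hx.smul_right z
    rw [(hBc _).eq, sub_self, norm_zero]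
    refine add_nonneg (norm_nonneg _) (mul_nonneg (by positivity) (Finset.sum_nonneg ?_))
    intro Z _
    exact intervalIntegral.integral_nonneg hst (fun _ _ => norm_nonneg _)
  rcases subsingleton_or_nontrivial A with hA1 | hA1
  · have hz : ∀ y : A, ‖y‖ = 0 := fun y => by rw [Subsingleton.elim y 0, norm_zero]
    simp [hz]
  set S := Λ.powerset.filter (fun Z => (Z ∩ X).Nonempty ∧ (Z \ X).Nonempty) with hS
  have hsub : Set.Icc s t ⊆ I := hI.out hs ht
  set u : ℝ → A := fun r => U r s with hu
  set v : ℝ → A := fun r => V r s with hv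
  set K : ℝ → A := fun r => Complex.I • ∑ Z ∈ Λ.powerset, Φ Z r with hK
  set L : ℝ → A := fun r => Complex.I • ∑ Z ∈ X.powerset, Φ Z r with hL
  set N : ℝ → A := fun r => Complex.I • ∑ Z ∈ S, Φ Z r with hN
  have uU : ∀ r ∈ I, u r ∈ unitary A := fun r hr => hUunitary s hs r hr
  have vU : ∀ r ∈ I, v r ∈ unitary A := fun r hr => hVunitary s hs r hr
  have uus : ∀ r ∈ I, u r * star (u r) = 1 := fun r hr => (Unitary.mem_iff.mp (uU r hr)).2
  have usu : ∀ r ∈ I, star (u r) * u r = 1 := fun r hr => (Unitary.mem_iff.mp (uU r hr)).1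
  have vvs : ∀ r ∈ I, v r * star (v r) = 1 := fun r hr => (Unitary.mem_iff.mp (vU r hr)).2
  have vsv : ∀ r ∈ I, star (v r) * v r = 1 := fun r hr => (Unitary.mem_iff.mp (vU r hr)).1
  have du : ∀ r ∈ I, HasDerivWithinAt u (-(K r * u r)) I r := by
    intro r hr
    have := hUode s hs r hr
    convert this using 1
    simp [hK, hu]
  have dv : ∀ r ∈ I, HasDerivWithinAt v (-(L r * v r)) I r := by
    intro r hr
    have := hVode s hs r hr
    convert this using 1
    simp [hL, hv]
  have dus : ∀ r ∈ I, HasDerivWithinAt (fun r => star (u r)) (star (u r) * K r) I r := by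
    intro r hr
    have := hasDeriv_star_unitary u _ I r hr uU (du r hr)
    convert this using 1
    rw [mul_neg, neg_mul, neg_neg, mul_assoc, mul_assoc, uus r hr, mul_one]
  have dvs : ∀ r ∈ I, HasDerivWithinAt (fun r => star (v r)) (star (v r) * L r) I r := by
    intro r hr
    have := hasDeriv_star_unitary v _ I r hr vU (dv r hr)
    convert this using 1
    rw [mul_neg, neg_mul, neg_neg, mul_assoc, mul_assoc, vvs r hr, mul_one]
  set C : A := star (v t) * A₀ * v t with hC
  set D : ℝ → A := fun r => v r * C * star (v r) with hD
  set G : ℝ → A := fun r => star (u r) * D r * u r with hG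
  -- the observable `D r` lives in `X`, hence commutes with even terms away from `X`
  have hcomZ : ∀ r ∈ I, ∀ Z : Finset Γ, Disjoint Z X → Commute (Φ Z r) (D r) := by
    intro r hr Z hZ
    have cV : ∀ r' ∈ I, Commute (Φ Z r) (v r') := fun r' hr' =>
      car_even_commute a hCAR Z X hZ _ _ (hΦeven Z r hr) (hVmem s hs r' hr')
    have cVs : ∀ r' ∈ I, Commute (Φ Z r) (star (v r')) := by
      intro r' hr'
      have h := (cV r' hr').eq
      show _ = _
      calc Φ Z r * star (v r') = star (v r') * v r' * (Φ Z r * star (v r')) := by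
            rw [vsv r' hr', one_mul]
        _ = star (v r') * (v r' * Φ Z r) * star (v r') := by simp only [mul_assoc]
        _ = star (v r') * (Φ Z r * v r') * star (v r') := by rw [h]
        _ = star (v r') * Φ Z r * (v r' * star (v r')) := by simp only [mul_assoc]
        _ = star (v r') * Φ Z r := by rw [vvs r' hr', mul_one]
    have cA : Commute (Φ Z r) A₀ := car_even_commute a hCAR Z X hZ _ _ (hΦeven Z r hr) hA
    exact ((cV r hr).mul_right (((cVs t ht).mul_right cA).mul_right (cV t ht))).mul_right (cVs r hr)
  have hcom : ∀ r ∈ I, Commute (K r - L r - N r) (D r) := by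
    intro r hr
    have e : K r - L r - N r = Complex.I • ∑ Z ∈ Λ.powerset, (Φ Z r
        - (if Z ⊆ X then Φ Z r else 0)
        - (if (Z ∩ X).Nonempty ∧ (Z \ X).Nonempty then Φ Z r else 0)) := by
      have e1 : X.powerset = Λ.powerset.filter (fun Z => Z ⊆ X) := by
        ext Z
        simp only [Finset.mem_powerset, Finset.mem_filter]
        exact ⟨fun h => ⟨h.trans hXΛ, h⟩, fun h => h.2⟩
      simp only [hK, hL, hN, hS, Finset.sum_sub_distrib, smul_sub, e1, Finset.sum_filter]
    rw [e]
    refine Commute.smul_left ?_ _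
    refine Commute.sum_left _ _ _ ?_
    intro Z _
    by_cases h1 : Z ⊆ X
    · have h2 : ¬ ((Z ∩ X).Nonempty ∧ (Z \ X).Nonempty) := by
        rintro ⟨-, h⟩
        rw [Finset.sdiff_eq_empty_iff_subset.mpr h1] at h
        exact Finset.not_nonempty_empty h
      rw [if_pos h1, if_neg h2]; simp
    · rw [if_neg h1]
      by_cases h2 : (Z ∩ X).Nonempty ∧ (Z \ X).Nonempty
      · rw [if_pos h2]; simp
      · rw [if_neg h2, sub_zero, sub_zero]
        apply hcomZ r hr
        rw [Finset.disjoint_iff_inter_eq_empty]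
        by_contra h3
        exact h2 ⟨Finset.nonempty_iff_ne_empty.mpr h3, Finset.sdiff_nonempty.mpr h1⟩
  set R : ℝ → A := fun r => star (u r) * N r * u r with hR
  have dG : ∀ r ∈ I, HasDerivWithinAt G (R r * G r - G r * R r) I r := by
    intro r hr
    have dD := ((dv r hr).mul_const C).mul (dvs r hr)
    have d := ((dus r hr).mul dD).mul (du r hr)
    refine HasDerivWithinAt.congr_deriv d ?_
    have c := (hcom r hr).eq
    have k1 : K r * D r - D r * K r - (L r * D r - D r * L r) = N r * D r - D r * N r := by
      have h0 := sub_eq_zero.mpr c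
      rw [← sub_eq_zero, ← h0]; noncomm_ring
    have k2 : R r * G r - G r * R r = star (u r) * (N r * D r - D r * N r) * u r := by
      have e1 : R r * G r = star (u r) * N r * (u r * star (u r)) * D r * u r := by
        simp only [hR, hG, mul_assoc]
      have e2 : G r * R r = star (u r) * D r * (u r * star (u r)) * N r * u r := by
        simp only [hR, hG, mul_assoc]
      rw [e1, e2, uus r hr]; noncomm_ring
    rw [k2, ← k1]
    simp only [hD, Pi.mul_apply]
    noncomm_ring
  set f : ℝ → A := fun r => G r * B₀ - B₀ * G r with hf
  set W : ℝ → A := fun r => R r * B₀ - B₀ * R r with hW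
  set w : Finset Γ → ℝ → A := fun Z r =>
    (star (u r) * Φ Z r * u r) * B₀ - B₀ * (star (u r) * Φ Z r * u r) with hw
  have cu : ContinuousOn u I := fun r hr => (du r hr).continuousWithinAt
  have cw : ∀ Z, ContinuousOn (fun r => ‖w Z r‖) (Set.Icc s t) := by
    intro Z
    have c1 : ContinuousOn (fun r => star (u r) * Φ Z r * u r) I :=
      ((cu.star).mul (hΦcont Z)).mul cu
    exact (((c1.mul continuousOn_const).sub (continuousOn_const.mul c1)).norm).mono hsub
  have nG : ∀ r ∈ I, ‖G r‖ = ‖A₀‖ := by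
    intro r hr
    have m1 := Unitary.star_mem (uU r hr)
    have m3 := Unitary.star_mem (vU r hr)
    have m4 := Unitary.star_mem (vU t ht)
    simp only [hG, hD, hC]
    rw [CStarRing.norm_mul_mem_unitary _ (uU r hr), CStarRing.norm_mem_unitary_mul _ m1,
      CStarRing.norm_mul_mem_unitary _ m3, CStarRing.norm_mem_unitary_mul _ (vU r hr),
      CStarRing.norm_mul_mem_unitary _ (vU t ht), CStarRing.norm_mem_unitary_mul _ m4]
  have nW : ∀ r, ‖W r‖ ≤ ∑ Z ∈ S, ‖w Z r‖ := by
    intro r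
    have e : W r = Complex.I • ∑ Z ∈ S, w Z r := by
      simp only [hW, hw, hR, hN, Finset.sum_sub_distrib, mul_smul_comm, smul_mul_assoc,
        Finset.mul_sum, Finset.sum_mul, smul_sub]
    rw [e, norm_smul, Complex.norm_I, one_mul]
    exact norm_sum_le _ _
  have main := norm_evol_le f R (fun r => W r * G r - G r * W r)
    (fun r => 2 * ‖A₀‖ * ∑ Z ∈ S, ‖w Z r‖) s t hst
    (continuousOn_const.mul (continuousOn_finsetSum _ (fun Z _ => cw Z))) ?_ ?_ ?_
  · have et : f t = (star (u t) * A₀ * u t) * B₀ - B₀ * (star (u t) * A₀ * u t) := by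
      have : D t = A₀ := by
        calc D t = (v t * star (v t)) * A₀ * (v t * star (v t)) := by
              simp only [hD, hC, mul_assoc]
          _ = A₀ := by rw [vvs t ht, one_mul, mul_one]
      simp only [hf, hG, this]
    have es : f s = C * B₀ - B₀ * C := by
      have h1 : u s = 1 := hUinit s hs
      have h2 : v s = 1 := hVinit s hs
      simp [hf, hG, hD, h1, h2]
    rw [et, es, intervalIntegral.integral_const_mul,
      intervalIntegral.integral_finsetSum (fun Z _ =>
        ContinuousOn.intervalIntegrable (by rw [Set.uIcc_of_le hst]; exact cw Z))] at main
    exact main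
  · intro r hr
    have hNs : star (N r) = -N r := by
      refine car_star_I a hCAR x₀ _ ?_
      rw [star_sum]
      exact Finset.sum_congr rfl (fun Z _ => hΦsa Z r (hsub hr))
    simp only [hR, star_mul, star_star, hNs]
    noncomm_ring
  · intro r hr
    calc ‖W r * G r - G r * W r‖ ≤ ‖W r * G r‖ + ‖G r * W r‖ := norm_sub_le _ _
      _ ≤ ‖W r‖ * ‖G r‖ + ‖G r‖ * ‖W r‖ := add_le_add (norm_mul_le _ _) (norm_mul_le _ _)
      _ = 2 * ‖A₀‖ * ‖W r‖ := by rw [nG r (hsub hr)]; ring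
      _ ≤ _ := by gcongr; exact nW r
  · intro r hr
    have d := (dG r (hsub hr)).mono hsub
    have d2 := (d.mul_const B₀).sub (d.const_mul B₀)
    refine HasDerivWithinAt.congr_deriv d2 ?_
    simp only [hf, hW]
    noncomm_ring
end
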